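/- arXiv:1103.0495 — 2 statements merged into one kernel-verified Lean document; each statement's English description precedes it below -/
import Mathlib

section
/- Let α > 0 and assume the standing hypotheses (H1)–(H3) with constant d ∈ [0,1). Then there exists M(α) > 0 such that for every integer n > 1 + M(α)/(2−2d) and every positive solution (u₁,…,u_n) ∈ (0,∞)ⁿ of the discrete system (Sα), the matrix J(α,u) is invertible and its inverse has entries (J⁻¹(α,u))_{ij} = Σ_{k=max(i,j)}^{n−1} (uᵢ′·u_j′)/(u_k′·u_{k+1}′) + (uᵢ′·u_j′)/(u_n′·det J(α,u)) for 1 ≤ i, j ≤ n, where u₁′ := 1 and u_k′ := U_k′(u₁) (the derivative with respect to u₁) for 2 ≤ k ≤ n. -/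
noncomputable section

/-- `Useq g1 h k` is the function `U_{k+1}` (0-indexed version of the recursion). -/
def Useq (g1 : ℝ → ℝ) (h : ℝ) : ℕ → ℝ → ℝ
  | 0 => fun x => x
  | 1 => fun x => x + h ^ 2 / 2 * g1 x
  | k + 2 => fun x =>
      2 * Useq g1 h (k + 1) x - Useq g1 h k x + h ^ 2 * g1 (Useq g1 h (k + 1) x)

/-- `discU g1 h k` is the function `U_k` from the paper, for `1 ≤ k`. -/
def discU (g1 : ℝ → ℝ) (h : ℝ) (k : ℕ) : ℝ → ℝ := Useq g1 h (k - 1)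

/-- The function `A(u₁)` from the paper. -/
def discA (g1 g2 : ℝ → ℝ) (h : ℝ) (n : ℕ) (x : ℝ) : ℝ :=
  ((discU g1 h n x - discU g1 h (n - 1) x) / h + h / 2 * g1 (discU g1 h n x)) /
    g2 (discU g1 h n x)

/-- `(u₁, …, u_n)` (encoded as `u : ℕ → ℝ` on indices `1,…,n`) is a positive solution of
the discrete system `(Sα)`. -/
def IsSolution (g1 g2 : ℝ → ℝ) (n : ℕ) (h α : ℝ) (u : ℕ → ℝ) : Prop :=
  (∀ k, 1 ≤ k → k ≤ n → 0 < u k) ∧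
  u 2 - u 1 = h ^ 2 / 2 * g1 (u 1) ∧
  (∀ k, 2 ≤ k → k ≤ n - 1 → u (k + 1) - 2 * u k + u (k - 1) = h ^ 2 * g1 (u k)) ∧
  u n - u (n - 1) = -(h ^ 2 / 2) * g1 (u n) + h * α * g2 (u n)

/-- `G₁`, the primitive of `g₁` vanishing at `0`. -/
def primG1 (g1 : ℝ → ℝ) (x : ℝ) : ℝ := ∫ t in (0:ℝ)..x, g1 t

/-- `g := g₁/g₂`. -/
def gg (g1 g2 : ℝ → ℝ) (x : ℝ) : ℝ := g1 x / g2 x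

/-- `G := G₁/g₂²`. -/
def GG (g1 g2 : ℝ → ℝ) (x : ℝ) : ℝ := primG1 g1 x / (g2 x) ^ 2

/-- The trapezoidal-rule error `E` as a function of `u₁`. -/
def trapError (g1 : ℝ → ℝ) (h : ℝ) (n : ℕ) (x : ℝ) : ℝ :=
  (∑ k ∈ Finset.Icc 1 (n - 1),
    (g1 (discU g1 h k x) + g1 (discU g1 h (k + 1) x)) / 2 *
      (discU g1 h (k + 1) x - discU g1 h k x)) -
  (primG1 g1 (discU g1 h n x) - primG1 g1 (discU g1 h 1 x))

/-- The Jacobian matrix `J(α,u)` of the system `(Sα)`. -/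
def Jmat (g1 g2 : ℝ → ℝ) (n : ℕ) (h α : ℝ) (u : ℕ → ℝ) : Matrix (Fin n) (Fin n) ℝ :=
  Matrix.of fun i j =>
    if i = j then
      (if (i : ℕ) = 0 then 1 + h ^ 2 / 2 * deriv g1 (u 1)
       else if (i : ℕ) = n - 1 then
         1 + h ^ 2 / 2 * deriv g1 (u n) - h * α * deriv g2 (u n)
       else 2 + h ^ 2 * deriv g1 (u ((i : ℕ) + 1)))
    else if (i : ℕ) + 1 = (j : ℕ) ∨ (j : ℕ) + 1 = (i : ℕ) then -1 else 0

/-- The properties of the nonlinearities that the estimates use. -/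
structure IsConvexSource (g : ℝ → ℝ) : Prop where
  contDiff : ContDiff ℝ 3 g
  map_zero : g 0 = 0
  deriv_pos : ∀ x > (0 : ℝ), 0 < deriv g x
  deriv_deriv_pos : ∀ x > (0 : ℝ), 0 < deriv (deriv g) x

namespace IsConvexSource

variable {g : ℝ → ℝ} {x y : ℝ}

lemma continuous (hg : IsConvexSource g) : Continuous g := hg.contDiff.continuous

lemma differentiable (hg : IsConvexSource g) : Differentiable ℝ g :=
  hg.contDiff.differentiable (by norm_num)

lemma hasDerivAt (hg : IsConvexSource g) (x : ℝ) : HasDerivAt g (deriv g x) x :=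
  (hg.differentiable x).hasDerivAt

lemma strictMonoOn_deriv (hg : IsConvexSource g) : StrictMonoOn (deriv g) (Set.Ici 0) :=
  strictMonoOn_of_deriv_pos (convex_Ici 0)
    (hg.contDiff.continuous_deriv (by norm_num)).continuousOn
    (by simpa using hg.deriv_deriv_pos)

lemma strictMonoOn (hg : IsConvexSource g) : StrictMonoOn g (Set.Ici 0) :=
  strictMonoOn_of_deriv_pos (convex_Ici 0) hg.continuous.continuousOn
    (by simpa using hg.deriv_pos)

lemma mono (hg : IsConvexSource g) (hx : 0 ≤ x) (hxy : x ≤ y) : g x ≤ g y :=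
  hg.strictMonoOn.monotoneOn hx (hx.trans hxy) hxy

lemma deriv_mono (hg : IsConvexSource g) (hx : 0 ≤ x) (hxy : x ≤ y) : deriv g x ≤ deriv g y :=
  hg.strictMonoOn_deriv.monotoneOn hx (hx.trans hxy) hxy

lemma pos (hg : IsConvexSource g) (hx : 0 < x) : 0 < g x := by
  simpa [hg.map_zero] using hg.strictMonoOn Set.self_mem_Ici hx.le hx

lemma sub_le (hg : IsConvexSource g) (hx : 0 ≤ x) (hxy : x ≤ y) :
    g y - g x ≤ deriv g y * (y - x) :=
  (convex_Icc x y).image_sub_le_mul_sub_of_deriv_le hg.continuous.continuousOn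
    hg.differentiable.differentiableOn
    (fun z hz => by
      rw [interior_Icc] at hz
      exact hg.deriv_mono (hx.trans hz.1.le) hz.2.le)
    x (Set.left_mem_Icc.2 hxy) y (Set.right_mem_Icc.2 hxy) hxy

lemma le_sub (hg : IsConvexSource g) (hx : 0 ≤ x) (hxy : x ≤ y) :
    deriv g x * (y - x) ≤ g y - g x :=
  (convex_Icc x y).mul_sub_le_image_sub_of_le_deriv hg.continuous.continuousOn
    hg.differentiable.differentiableOn
    (fun z hz => by
      rw [interior_Icc] at hz
      exact hg.deriv_mono hx hz.1.le)
    x (Set.left_mem_Icc.2 hxy) y (Set.right_mem_Icc.2 hxy) hxy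

lemma le_deriv_mul (hg : IsConvexSource g) (hx : 0 ≤ x) : g x ≤ deriv g x * x := by
  simpa [hg.map_zero] using hg.sub_le le_rfl hx

lemma hasDerivAt_primG1 (hg : IsConvexSource g) (x : ℝ) : HasDerivAt (primG1 g) (g x) x :=
  intervalIntegral.integral_hasDerivAt_right (hg.continuous.intervalIntegrable _ _)
    (hg.continuous.stronglyMeasurableAtFilter _ _) hg.continuous.continuousAt

lemma continuous_primG1 (hg : IsConvexSource g) : Continuous (primG1 g) :=
  continuous_iff_continuousAt.2 fun x => (hg.hasDerivAt_primG1 x).continuousAt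

lemma differentiable_primG1 (hg : IsConvexSource g) : Differentiable ℝ (primG1 g) :=
  fun x => (hg.hasDerivAt_primG1 x).differentiableAt

lemma primG1_sub_le (hg : IsConvexSource g) (hx : 0 ≤ x) (hxy : x ≤ y) :
    primG1 g y - primG1 g x ≤ g y * (y - x) :=
  (convex_Icc x y).image_sub_le_mul_sub_of_deriv_le hg.continuous_primG1.continuousOn
    hg.differentiable_primG1.differentiableOn
    (fun z hz => by
      rw [interior_Icc] at hz
      rw [(hg.hasDerivAt_primG1 z).deriv]
      exact hg.mono (hx.trans hz.1.le) hz.2.le)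
    x (Set.left_mem_Icc.2 hxy) y (Set.right_mem_Icc.2 hxy) hxy

lemma le_primG1_sub (hg : IsConvexSource g) (hx : 0 ≤ x) (hxy : x ≤ y) :
    g x * (y - x) ≤ primG1 g y - primG1 g x :=
  (convex_Icc x y).mul_sub_le_image_sub_of_le_deriv hg.continuous_primG1.continuousOn
    hg.differentiable_primG1.differentiableOn
    (fun z hz => by
      rw [interior_Icc] at hz
      rw [(hg.hasDerivAt_primG1 z).deriv]
      exact hg.mono hx hz.1.le)
    x (Set.left_mem_Icc.2 hxy) y (Set.right_mem_Icc.2 hxy) hxy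

lemma primG1_zero : primG1 g 0 = 0 := intervalIntegral.integral_same

lemma primG1_mono (hg : IsConvexSource g) (hx : 0 < x) (hxy : x ≤ y) :
    primG1 g x ≤ primG1 g y := by
  nlinarith [hg.le_primG1_sub hx.le hxy, mul_nonneg (hg.pos hx).le (sub_nonneg.2 hxy)]

lemma primG1_pos (hg : IsConvexSource g) (hx : 0 < x) : 0 < primG1 g x := by
  have h1 := hg.le_primG1_sub (half_pos hx).le (half_le_self hx.le)
  have h2 := hg.le_primG1_sub le_rfl (half_pos hx).le
  rw [primG1_zero, hg.map_zero] at h2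
  nlinarith [mul_pos (hg.pos (half_pos hx)) hx]

/-- Convexity of the primitive, in the form of a secant inequality through the origin. -/
lemma primG1_mul_le (hg : IsConvexSource g) (hx : 0 < x) (hxy : x ≤ y) :
    primG1 g x * y ≤ x * primG1 g y := by
  have h1 := hg.le_primG1_sub hx.le hxy
  have h2 := hg.primG1_sub_le le_rfl hx.le
  rw [primG1_zero] at h2
  nlinarith [mul_le_mul_of_nonneg_left h1 hx.le,
    mul_le_mul_of_nonneg_right h2 (sub_nonneg.2 hxy)]

/-- Convexity of `g`, in the form of a secant inequality through the origin. -/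
lemma mul_le_mul (hg : IsConvexSource g) (hx : 0 < x) (hxy : x ≤ y) : g x * y ≤ x * g y := by
  nlinarith [mul_le_mul_of_nonneg_left (hg.le_sub hx.le hxy) hx.le,
    mul_le_mul_of_nonneg_right (hg.le_deriv_mul hx.le) (sub_nonneg.2 hxy)]

lemma sq_le_two_mul_primG1_mul_deriv (hg : IsConvexSource g) (hx : 0 ≤ x) :
    g x ^ 2 ≤ 2 * primG1 g x * deriv g x := by
  have hder : ∀ y, HasDerivAt (fun y => 2 * primG1 g y * deriv g x - g y ^ 2)
      (2 * g y * (deriv g x - deriv g y)) y := fun y =>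
    ((((hg.hasDerivAt_primG1 y).const_mul 2).mul_const (deriv g x)).sub
      ((hg.hasDerivAt y).pow 2)).congr_deriv (by push_cast; ring)
  have hmono : MonotoneOn (fun y => 2 * primG1 g y * deriv g x - g y ^ 2) (Set.Icc 0 x) := by
    refine monotoneOn_of_deriv_nonneg (convex_Icc 0 x)
      (fun y _ => (hder y).continuousAt.continuousWithinAt)
      (fun y _ => (hder y).differentiableAt.differentiableWithinAt) fun y hy => ?_
    rw [interior_Icc] at hy
    rw [(hder y).deriv]
    exact mul_nonneg (mul_nonneg zero_le_two (hg.pos hy.1).le)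
      (sub_nonneg.2 (hg.deriv_mono hy.1.le hy.2.le))
  have := hmono (Set.left_mem_Icc.2 hx) (Set.right_mem_Icc.2 hx) hx
  simp only [primG1_zero, hg.map_zero] at this
  linarith

end IsConvexSource

lemma le_exp_mul_of_le_one_add_mul {y : ℕ → ℝ} {c : ℝ} {N : ℕ} (hc : 0 ≤ c) (hy : 0 ≤ y 0)
    (hstep : ∀ k < N, y (k + 1) ≤ (1 + c) * y k) : y N ≤ Real.exp (N * c) * y 0 := by
  have key : ∀ k ≤ N, y k ≤ (1 + c) ^ k * y 0 := by
    intro k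
    induction k with
    | zero => simp
    | succ k ih =>
      intro hk
      calc y (k + 1) ≤ (1 + c) * y k := hstep k hk
        _ ≤ (1 + c) * ((1 + c) ^ k * y 0) := by gcongr; exact ih (by omega)
        _ = (1 + c) ^ (k + 1) * y 0 := by ring
  refine (key N le_rfl).trans (mul_le_mul_of_nonneg_right ?_ hy)
  rw [Real.exp_nat_mul]
  gcongr
  linarith [Real.add_one_le_exp c]

/-- A positive sequence `x` solving the discretized equation `x'' = g(x)` with a discrete
Neumann condition at the left end, with `v` solving its linearization. -/
structure IsLinearizedOrbit (g : ℝ → ℝ) (h : ℝ) (x v : ℕ → ℝ) : Prop where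
  pos_zero : 0 < x 0
  one : x 1 = x 0 + h ^ 2 / 2 * g (x 0)
  add_two : ∀ k, x (k + 2) = 2 * x (k + 1) - x k + h ^ 2 * g (x (k + 1))
  lin_zero : v 0 = 1
  lin_one : v 1 = 1 + h ^ 2 / 2 * deriv g (x 0)
  lin_add_two : ∀ k, v (k + 2) =
    2 * v (k + 1) - v k + h ^ 2 * (deriv g (x (k + 1)) * v (k + 1))

namespace IsLinearizedOrbit

variable {g : ℝ → ℝ} {h : ℝ} {x v : ℕ → ℝ}

lemma pos_and_le (ho : IsLinearizedOrbit g h x v) (hg : IsConvexSource g) (k : ℕ) :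
    0 < x k ∧ x k ≤ x (k + 1) := by
  induction k with
  | zero =>
    refine ⟨ho.pos_zero, ?_⟩
    have := mul_nonneg (sq_nonneg h) (hg.pos ho.pos_zero).le
    rw [zero_add, ho.one]
    nlinarith
  | succ k ih =>
    have hp : 0 < x (k + 1) := ih.1.trans_le ih.2
    refine ⟨hp, ?_⟩
    rw [ho.add_two]
    nlinarith [mul_nonneg (sq_nonneg h) (hg.pos hp).le]

lemma pos (ho : IsLinearizedOrbit g h x v) (hg : IsConvexSource g) (k : ℕ) : 0 < x k :=
  (ho.pos_and_le hg k).1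

lemma le_succ (ho : IsLinearizedOrbit g h x v) (hg : IsConvexSource g) (k : ℕ) :
    x k ≤ x (k + 1) :=
  (ho.pos_and_le hg k).2

lemma monotone (ho : IsLinearizedOrbit g h x v) (hg : IsConvexSource g) : Monotone x :=
  monotone_nat_of_le_succ (ho.le_succ hg)

lemma lin_one_le_and_le (ho : IsLinearizedOrbit g h x v) (hg : IsConvexSource g) (k : ℕ) :
    1 ≤ v k ∧ v k ≤ v (k + 1) := by
  induction k with
  | zero =>
    refine ⟨ho.lin_zero.ge, ?_⟩
    rw [zero_add, ho.lin_one, ho.lin_zero]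
    have := hg.deriv_pos _ ho.pos_zero
    have : 0 ≤ h ^ 2 / 2 * deriv g (x 0) := by positivity
    linarith
  | succ k ih =>
    have hp : 1 ≤ v (k + 1) := ih.1.trans ih.2
    refine ⟨hp, ?_⟩
    rw [ho.lin_add_two]
    have hr := hg.deriv_pos _ (ho.pos hg (k + 1))
    have : 0 ≤ h ^ 2 * (deriv g (x (k + 1)) * v (k + 1)) := by positivity
    linarith

lemma one_le_lin (ho : IsLinearizedOrbit g h x v) (hg : IsConvexSource g) (k : ℕ) : 1 ≤ v k :=
  (ho.lin_one_le_and_le hg k).1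

lemma lin_le_succ (ho : IsLinearizedOrbit g h x v) (hg : IsConvexSource g) (k : ℕ) :
    v k ≤ v (k + 1) :=
  (ho.lin_one_le_and_le hg k).2

lemma lin_monotone (ho : IsLinearizedOrbit g h x v) (hg : IsConvexSource g) : Monotone v :=
  monotone_nat_of_le_succ (ho.lin_le_succ hg)

lemma step_le (ho : IsLinearizedOrbit g h x v) (hg : IsConvexSource g) (k : ℕ) :
    x (k + 1) - x k ≤ (k + 1 / 2) * h ^ 2 * g (x k) := by
  induction k with
  | zero => rw [zero_add, ho.one]; norm_num; linarith
  | succ k ih =>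
    have hm := hg.mono (ho.pos hg k).le (ho.le_succ hg k)
    have : (k + 1 / 2) * h ^ 2 * g (x k) ≤ (k + 1 / 2) * h ^ 2 * g (x (k + 1)) := by gcongr
    rw [ho.add_two]
    push_cast
    linarith

lemma le_step (ho : IsLinearizedOrbit g h x v) (hg : IsConvexSource g) (k : ℕ) :
    (k + 1 / 2) * h ^ 2 * g (x 0) ≤ x (k + 1) - x k := by
  induction k with
  | zero => rw [zero_add, ho.one]; norm_num; linarith
  | succ k ih =>
    have hm := hg.mono (ho.pos_zero).le (ho.monotone hg (Nat.zero_le (k + 1)))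
    have : h ^ 2 * g (x 0) ≤ h ^ 2 * g (x (k + 1)) := by gcongr
    rw [ho.add_two]
    push_cast
    linarith

lemma le_sub_zero (ho : IsLinearizedOrbit g h x v) (hg : IsConvexSource g) (k : ℕ) :
    k ^ 2 / 2 * h ^ 2 * g (x 0) ≤ x k - x 0 := by
  induction k with
  | zero => simp
  | succ k ih =>
    have := ho.le_step hg k
    push_cast
    linarith

lemma lin_step_le (ho : IsLinearizedOrbit g h x v) (hg : IsConvexSource g) (k : ℕ) :
    v (k + 1) - v k ≤ (k + 1 / 2) * h ^ 2 * (deriv g (x k) * v k) := by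
  induction k with
  | zero => rw [zero_add, ho.lin_one, ho.lin_zero]; norm_num; linarith
  | succ k ih =>
    have hv := ho.one_le_lin hg k
    have hr := hg.deriv_pos _ (ho.pos hg (k + 1))
    have hm := mul_le_mul (hg.deriv_mono (ho.pos hg k).le (ho.le_succ hg k))
      (ho.lin_le_succ hg k) (by linarith) hr.le
    have : (k + 1 / 2) * h ^ 2 * (deriv g (x k) * v k) ≤
        (k + 1 / 2) * h ^ 2 * (deriv g (x (k + 1)) * v (k + 1)) := by gcongr
    rw [ho.lin_add_two]
    push_cast
    linarith

/-- Lower bound for the discrete Wronskian. -/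
lemma le_step_mul_lin_step (ho : IsLinearizedOrbit g h x v) (hg : IsConvexSource g) (k : ℕ) :
    h ^ 2 * (g (x k) * v k - g (x 0)) ≤ (x (k + 1) - x k) * (v (k + 1) - v k) := by
  induction k with
  | zero =>
    rw [ho.lin_zero, mul_one, sub_self, mul_zero, ← ho.lin_zero]
    exact mul_nonneg (sub_nonneg.2 (ho.le_succ hg 0)) (sub_nonneg.2 (ho.lin_le_succ hg 0))
  | succ k ih =>
    have hp := hg.pos (ho.pos hg (k + 1))
    have hr := hg.deriv_pos _ (ho.pos hg (k + 1))
    have hv := ho.one_le_lin hg (k + 1)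
    have hv' := ho.one_le_lin hg k
    have hgs := hg.sub_le (ho.pos hg k).le (ho.le_succ hg k)
    have ht := sub_nonneg.2 (ho.lin_le_succ hg k)
    have hs := sub_nonneg.2 (ho.le_succ hg k)
    have hx2 : x (k + 2) - x (k + 1) = x (k + 1) - x k + h ^ 2 * g (x (k + 1)) := by
      rw [ho.add_two]; ring
    have hv2 : v (k + 2) - v (k + 1) =
        v (k + 1) - v k + h ^ 2 * (deriv g (x (k + 1)) * v (k + 1)) := by
      rw [ho.lin_add_two]; ring
    rw [hx2, hv2]
    have e1 : 0 ≤ h ^ 2 * (v k * (deriv g (x (k + 1)) * (x (k + 1) - x k)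
        - (g (x (k + 1)) - g (x k)))) :=
      mul_nonneg (sq_nonneg h) (mul_nonneg (by linarith) (sub_nonneg.2 hgs))
    have e2 : 0 ≤ h ^ 2 * ((deriv g (x (k + 1)) * (x (k + 1) - x k)) * (v (k + 1) - v k)) := by
      positivity
    have e3 : 0 ≤ h ^ 2 * g (x (k + 1)) * (h ^ 2 * (deriv g (x (k + 1)) * v (k + 1))) := by
      positivity
    linarith

/-- Upper bound for the discrete Wronskian. -/
lemma step_mul_lin_step_le (ho : IsLinearizedOrbit g h x v) (hg : IsConvexSource g) (k : ℕ) :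
    (x (k + 1) - x k) * (v (k + 1) - v k) ≤ h ^ 2 * (g (x (k + 1)) * v (k + 1) - g (x 0)) := by
  induction k with
  | zero =>
    have hp := hg.pos ho.pos_zero
    have hr := hg.deriv_pos _ ho.pos_zero
    have hgs := hg.le_sub ho.pos_zero.le (ho.le_succ hg 0)
    rw [zero_add] at *
    have hs : x 1 - x 0 = h ^ 2 / 2 * g (x 0) := by rw [ho.one]; ring
    have hv : v 1 - v 0 = h ^ 2 / 2 * deriv g (x 0) := by rw [ho.lin_one, ho.lin_zero]; ring
    have hv1 : 1 ≤ v 1 := ho.one_le_lin hg 1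
    rw [hs] at hgs
    have hg1 := hg.pos (ho.pos hg 1)
    have e0 : 0 ≤ deriv g (x 0) * (h ^ 2 / 2 * g (x 0)) := by positivity
    have e1 : g (x 1) * 1 ≤ g (x 1) * v 1 := by gcongr
    have e2 : h ^ 2 * (deriv g (x 0) * (h ^ 2 / 2 * g (x 0))) ≤
        h ^ 2 * (g (x 1) * v 1 - g (x 0)) := by gcongr; linarith
    rw [hs, hv]
    nlinarith [mul_nonneg (sq_nonneg h) e0]
  | succ k ih =>
    have hp := hg.pos (ho.pos hg (k + 1))
    have hp2 := hg.pos (ho.pos hg (k + 2))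
    have hr := hg.deriv_pos _ (ho.pos hg (k + 1))
    have hv := ho.one_le_lin hg (k + 1)
    have hgs := hg.le_sub (ho.pos hg (k + 1)).le (ho.le_succ hg (k + 1))
    have ht := sub_nonneg.2 (ho.lin_le_succ hg k)
    have hx2 : x (k + 1) - x k = x (k + 2) - x (k + 1) - h ^ 2 * g (x (k + 1)) := by
      rw [ho.add_two]; ring
    have hv2 : v (k + 1) - v k =
        v (k + 2) - v (k + 1) - h ^ 2 * (deriv g (x (k + 1)) * v (k + 1)) := by
      rw [ho.lin_add_two]; ring
    have hs := sub_nonneg.2 (ho.le_succ hg (k + 1))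
    have ht2 := sub_nonneg.2 (ho.lin_le_succ hg (k + 1))
    have hg2 : 0 ≤ deriv g (x (k + 1)) * (x (k + 2) - x (k + 1)) := by positivity
    rw [hx2] at ih
    rw [hv2] at ih
    have e1 : 0 ≤ h ^ 2 * (v (k + 2) * (g (x (k + 2)) - g (x (k + 1))
        - deriv g (x (k + 1)) * (x (k + 2) - x (k + 1)))) :=
      mul_nonneg (sq_nonneg h)
        (mul_nonneg (by linarith [ho.one_le_lin hg (k + 2)]) (sub_nonneg.2 hgs))
    have e2 : 0 ≤ h ^ 2 * ((deriv g (x (k + 1)) * (x (k + 2) - x (k + 1)))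
        * (v (k + 2) - v (k + 1))) := by positivity
    have e3 : 0 ≤ h ^ 2 * g (x (k + 1)) * (h ^ 2 * (deriv g (x (k + 1)) * v (k + 1))) := by
      positivity
    linarith

/-- Discrete energy inequality. -/
lemma step_sq_le (ho : IsLinearizedOrbit g h x v) (hg : IsConvexSource g) (k : ℕ) :
    (x (k + 1) - x k) ^ 2 ≤ 2 * h ^ 2 * (primG1 g (x (k + 1)) - primG1 g (x 0)) := by
  have hG (k : ℕ) := hg.le_primG1_sub (ho.pos hg k).le (ho.le_succ hg k)
  induction k with
  | zero =>
    have hs : x 1 - x 0 = h ^ 2 / 2 * g (x 0) := by rw [ho.one]; ring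
    have h0 := hG 0
    have hp := hg.pos ho.pos_zero
    rw [zero_add] at *
    have := mul_le_mul_of_nonneg_left h0 (sq_nonneg h)
    rw [hs] at this ⊢
    nlinarith [mul_nonneg (sq_nonneg h) (mul_nonneg (sq_nonneg h) (sq_nonneg (g (x 0))))]
  | succ k ih =>
    have hx2 : x (k + 2) - x (k + 1) = x (k + 1) - x k + h ^ 2 * g (x (k + 1)) := by
      rw [ho.add_two]; ring
    have h0 := mul_le_mul_of_nonneg_left (hG (k + 1)) (sq_nonneg h)
    rw [hx2] at h0 ⊢
    nlinarith [sq_nonneg (h ^ 2 * g (x (k + 1)))]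

/-- Reverse discrete energy inequality. -/
lemma le_step_sq (ho : IsLinearizedOrbit g h x v) (hg : IsConvexSource g) (k : ℕ) :
    2 * h ^ 2 * (primG1 g (x (k + 1)) - primG1 g (x 0)) ≤
      (x (k + 1) - x k) ^ 2 + 2 * h ^ 2 * (g (x (k + 1)) * (x (k + 1) - x k)) := by
  have hG (k : ℕ) := mul_le_mul_of_nonneg_left
    (hg.primG1_sub_le (ho.pos hg k).le (ho.le_succ hg k)) (sq_nonneg h)
  induction k with
  | zero =>
    have h0 := hG 0
    rw [zero_add] at *
    nlinarith [sq_nonneg (x 1 - x 0)]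
  | succ k ih =>
    have hx2 : x (k + 2) - x (k + 1) = x (k + 1) - x k + h ^ 2 * g (x (k + 1)) := by
      rw [ho.add_two]; ring
    have h0 := hG (k + 1)
    rw [hx2] at h0 ⊢
    nlinarith [sq_nonneg (h ^ 2 * g (x (k + 1)))]

/-- The logarithmic derivative of the step is almost bounded below by `g (x 0) / 2` over the
primitive at `x 0`. -/
lemma lin_step_lower_bound (ho : IsLinearizedOrbit g h x v) (hg : IsConvexSource g) {ε : ℝ}
    {N : ℕ} (hε : 0 ≤ ε)
    (hN : ∀ k < N, g (x 0) * g (x (k + 1)) * (x (k + 1) - x k) ≤ 2 * ε * primG1 g (x 0)) :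
    ∀ k ≤ N, (g (x 0) / 2 - ε) * (x (k + 1) - x k) ≤ primG1 g (x 0) * (v (k + 1) - v k) := by
  intro k
  have ha := hg.primG1_pos ho.pos_zero
  have hb := hg.pos ho.pos_zero
  induction k with
  | zero =>
    intro _
    have hs : x 1 - x 0 = h ^ 2 / 2 * g (x 0) := by rw [ho.one]; ring
    have hv : v 1 - v 0 = h ^ 2 / 2 * deriv g (x 0) := by rw [ho.lin_one, ho.lin_zero]; ring
    rw [zero_add, hs, hv]
    have := mul_le_mul_of_nonneg_left (hg.sq_le_two_mul_primG1_mul_deriv ho.pos_zero.le)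
      (sq_nonneg h)
    have : 0 ≤ ε * (h ^ 2 / 2 * g (x 0)) := by positivity
    nlinarith
  | succ k ih =>
    intro hk
    have ih := ih (by omega)
    have hN := hN k (by omega)
    have hx2 : x (k + 2) - x (k + 1) = x (k + 1) - x k + h ^ 2 * g (x (k + 1)) := by
      rw [ho.add_two]; ring
    have hv2 : v (k + 2) - v (k + 1) =
        v (k + 1) - v k + h ^ 2 * (deriv g (x (k + 1)) * v (k + 1)) := by
      rw [ho.lin_add_two]; ring
    rw [hx2, hv2]
    have hp := hg.pos (ho.pos hg (k + 1))
    have hr := hg.deriv_pos _ (ho.pos hg (k + 1))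
    have hv := ho.one_le_lin hg (k + 1)
    have hs := sub_nonneg.2 (ho.le_succ hg k)
    have hG := hg.primG1_pos (ho.pos hg (k + 1))
    have hsq := hg.sq_le_two_mul_primG1_mul_deriv (ho.pos hg (k + 1)).le
    have hW := ho.step_mul_lin_step_le hg k
    have hE := ho.step_sq_le hg k
    have hE' := ho.le_step_sq hg k
    generalize x (k + 1) - x k = s at *
    generalize v (k + 1) - v k = t at *
    generalize g (x (k + 1)) = p at *
    generalize deriv g (x (k + 1)) = r at *
    generalize primG1 g (x (k + 1)) = G at *
    generalize v (k + 1) = w at *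
    generalize primG1 g (x 0) = a at *
    generalize g (x 0) = b at *
    -- the increment of the defect is controlled after multiplication by `2 * G`
    suffices hmain : 0 ≤ h ^ 2 * (a * (r * w) - (b / 2 - ε) * p) by nlinarith
    have h1 : a * (s * t) ≤ a * (h ^ 2 * (p * w - b)) := by gcongr
    have h2 : s * ((b / 2 - ε) * s) ≤ s * (a * t) := by gcongr
    have h3 : b / 2 * (2 * h ^ 2 * (G - a)) ≤ b / 2 * (s ^ 2 + 2 * h ^ 2 * (p * s)) := by
      gcongr
    have h4 : ε * s ^ 2 ≤ ε * (2 * h ^ 2 * (G - a)) := by gcongr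
    have h5 : h ^ 2 * (b * p * s) ≤ h ^ 2 * (2 * ε * a) := by gcongr
    have h6 : 0 ≤ h ^ 2 * (a * (p * w) - b * G + 2 * ε * G) := by nlinarith
    have h7 : h ^ 2 * (a * w) * p ^ 2 ≤ h ^ 2 * (a * w) * (2 * G * r) := by gcongr
    have h8 : 0 ≤ (2 * G) * (h ^ 2 * (a * (r * w) - (b / 2 - ε) * p)) := by
      nlinarith [mul_nonneg hp.le h6]
    exact nonneg_of_mul_nonneg_right h8 (by positivity)

end IsLinearizedOrbit

namespace IsLinearizedOrbit

variable {g : ℝ → ℝ} {h : ℝ} {x v : ℕ → ℝ} {m : ℕ}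

lemma step_le_mul (ho : IsLinearizedOrbit g h x v) (hg : IsConvexSource g)
    (hm : ((m : ℝ) + 1) * h = 1) {k : ℕ} (hk : k ≤ m) : x (k + 1) - x k ≤ h * g (x k) := by
  have hh : 0 < h := pos_of_mul_pos_right (hm ▸ one_pos) (by positivity)
  refine (ho.step_le hg k).trans ?_
  have hkm : (k : ℝ) ≤ m := by exact_mod_cast hk
  have : ((k : ℝ) + 1 / 2) * h ≤ 1 := by nlinarith
  nlinarith [mul_nonneg (sub_nonneg.2 this) (mul_pos hh (hg.pos (ho.pos hg k))).le]

lemma lin_step_le_mul (ho : IsLinearizedOrbit g h x v) (hg : IsConvexSource g)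
    (hm : ((m : ℝ) + 1) * h = 1) {k : ℕ} (hk : k ≤ m) :
    v (k + 1) - v k ≤ h * (deriv g (x k) * v k) := by
  have hh : 0 < h := pos_of_mul_pos_right (hm ▸ one_pos) (by positivity)
  refine (ho.lin_step_le hg k).trans ?_
  have hkm : (k : ℝ) ≤ m := by exact_mod_cast hk
  have : ((k : ℝ) + 1 / 2) * h ≤ 1 := by nlinarith
  have hv : 0 < v k := by linarith [ho.one_le_lin hg k]
  have hr := hg.deriv_pos _ (ho.pos hg k)
  have : 0 < h * (deriv g (x k) * v k) := by positivity
  nlinarith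

lemma le_exp_mul (ho : IsLinearizedOrbit g h x v) (hg : IsConvexSource g)
    (hm : ((m : ℝ) + 1) * h = 1) {B : ℝ} (hB : x (m + 1) ≤ B) :
    x (m + 1) ≤ Real.exp (deriv g B) * x 0 := by
  have hh : 0 < h := pos_of_mul_pos_right (hm ▸ one_pos) (by positivity)
  have hL := hg.deriv_pos B ((ho.pos hg _).trans_le hB)
  convert le_exp_mul_of_le_one_add_mul (c := h * deriv g B) (N := m + 1) (by positivity)
    ho.pos_zero.le fun k hk => ?_ using 3
  · push_cast; rw [← mul_assoc, hm, one_mul]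
  · have hx := ho.pos hg k
    have h1 := ho.step_le_mul hg hm (Nat.lt_succ_iff.1 hk)
    have h2 : deriv g (x k) ≤ deriv g B :=
      hg.deriv_mono hx.le ((ho.monotone hg hk.le).trans hB)
    have h3 : h * g (x k) ≤ h * (deriv g B * x k) := by
      gcongr
      exact (hg.le_deriv_mul hx.le).trans (by gcongr)
    linarith

lemma lin_le_exp (ho : IsLinearizedOrbit g h x v) (hg : IsConvexSource g)
    (hm : ((m : ℝ) + 1) * h = 1) {B : ℝ} (hB : x (m + 1) ≤ B) :
    v (m + 1) ≤ Real.exp (deriv g B) := by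
  have hh : 0 < h := pos_of_mul_pos_right (hm ▸ one_pos) (by positivity)
  have hL := hg.deriv_pos B ((ho.pos hg _).trans_le hB)
  have key := le_exp_mul_of_le_one_add_mul (y := v) (c := h * deriv g B) (N := m + 1)
    (by positivity) (by rw [ho.lin_zero]; exact zero_le_one) fun k hk => by
      have hx := ho.pos hg k
      have hv : 0 < v k := by linarith [ho.one_le_lin hg k]
      have h1 := ho.lin_step_le_mul hg hm (Nat.lt_succ_iff.1 hk)
      have h2 : deriv g (x k) ≤ deriv g B :=
        hg.deriv_mono hx.le ((ho.monotone hg hk.le).trans hB)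
      have h3 : h * (deriv g (x k) * v k) ≤ h * (deriv g B * v k) := by gcongr
      linarith
  rw [ho.lin_zero, mul_one] at key
  convert key using 2
  push_cast; rw [← mul_assoc, hm, one_mul]

/-- For a fine discretization, the linearized flux at the right end dominates the step. -/
lemma mul_step_lt (ho : IsLinearizedOrbit g h x v) (hg : IsConvexSource g)
    (hm : ((m : ℝ) + 1) * h = 1) {c B d : ℝ} (hd0 : 0 ≤ d) (hd1 : d < 1) (hc : 0 < c)
    (hcx : c ≤ x 0) (hB : x (m + 1) ≤ B)
    (hfine : h * (g B ^ 2 / primG1 g c +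
      3 * (g B * deriv g B * Real.exp (deriv g B)) / g c) < 1 - d) :
    d * g (x (m + 1)) * v (m + 1) * (x (m + 1) - x m) <
      2 * primG1 g (x (m + 1)) * (v (m + 1) - v m) := by
  have hh : 0 < h := pos_of_mul_pos_right (hm ▸ one_pos) (by positivity)
  have hh1 : h ≤ 1 := by nlinarith [(Nat.cast_nonneg m : (0 : ℝ) ≤ m)]
  have ha := hg.primG1_pos ho.pos_zero
  have hb := hg.pos ho.pos_zero
  have hac := hg.primG1_mono hc hcx
  have hbc := hg.mono hc.le hcx
  have hc1 := hg.primG1_pos hc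
  have hc2 := hg.pos hc
  have hxB (k : ℕ) (hk : k ≤ m + 1) : x k ≤ B := (ho.monotone hg hk).trans hB
  have hpB (k : ℕ) (hk : k ≤ m + 1) : g (x k) ≤ g B := hg.mono (ho.pos hg k).le (hxB k hk)
  have hsB (k : ℕ) (hk : k ≤ m) : x (k + 1) - x k ≤ h * g B :=
    (ho.step_le_mul hg hm hk).trans (by gcongr; exact hpB k (by omega))
  have hPB : 0 < g B := (hg.pos (ho.pos hg 0)).trans_le (hpB 0 (by omega))
  have hLB := hg.deriv_pos B ((ho.pos hg _).trans_le hB)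
  have hlow := ho.lin_step_lower_bound hg (N := m)
    (ε := h * g (x 0) * g B ^ 2 / (2 * primG1 g (x 0))) (by positivity) (fun k hk => by
      calc g (x 0) * g (x (k + 1)) * (x (k + 1) - x k) ≤ g (x 0) * g B * (h * g B) := by
            have := hpB (k + 1) (by omega)
            have := hsB k (by omega)
            have := sub_nonneg.2 (ho.le_succ hg k)
            gcongr
        _ = _ := by field_simp) m le_rfl
  have hε : 2 * (h * g (x 0) * g B ^ 2 / (2 * primG1 g (x 0))) ≤
      h * g (x 0) * (g B ^ 2 / primG1 g c) := by
    calc _ = h * g (x 0) * (g B ^ 2 / primG1 g (x 0)) := by field_simp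
      _ ≤ _ := by gcongr
  have hspos : 0 < x (m + 1) - x m := lt_of_lt_of_le (by positivity) (ho.le_step hg m)
  have ht := sub_nonneg.2 (ho.lin_le_succ hg m)
  have hE := ho.step_sq_le hg m
  have hW := ho.le_step_mul_lin_step hg (m + 1)
  have hx2 : x (m + 2) - x (m + 1) = x (m + 1) - x m + h ^ 2 * g (x (m + 1)) := by
    rw [ho.add_two]; ring
  have hv2 : v (m + 2) - v (m + 1) =
      v (m + 1) - v m + h ^ 2 * (deriv g (x (m + 1)) * v (m + 1)) := by
    rw [ho.lin_add_two]; ring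
  have hv0 : 0 < v m := by linarith [ho.one_le_lin hg m]
  have hv1 : 0 < v (m + 1) := by linarith [ho.one_le_lin hg (m + 1)]
  have hv := ho.lin_le_exp hg hm hB
  have hr := hg.deriv_pos _ (ho.pos hg (m + 1))
  have hp := hg.pos (ho.pos hg (m + 1))
  have hrB := hg.deriv_mono (ho.pos hg (m + 1)).le hB
  have hrB' := hg.deriv_mono (ho.pos hg m).le (hxB m (by omega))
  have htB : v (m + 1) - v m ≤ h * (deriv g B * Real.exp (deriv g B)) :=
    (ho.lin_step_le_mul hg hm le_rfl).trans (by
      gcongr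
      exact (ho.lin_le_succ hg m).trans hv)
  have hpB' := hpB (m + 1) le_rfl
  have hsB' := hsB m le_rfl
  rw [hx2, hv2] at hW
  have herr : g (x (m + 1)) * (v (m + 1) - v m)
      + deriv g (x (m + 1)) * v (m + 1) * (x (m + 1) - x m)
      + h ^ 2 * (g (x (m + 1)) * (deriv g (x (m + 1)) * v (m + 1))) ≤
      h * (3 * (g B * deriv g B * Real.exp (deriv g B)) / g c) * g (x 0) := by
    have e1 : g (x (m + 1)) * (v (m + 1) - v m) ≤
        g B * (h * (deriv g B * Real.exp (deriv g B))) := by gcongr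
    have e2 : deriv g (x (m + 1)) * v (m + 1) * (x (m + 1) - x m) ≤
        deriv g B * Real.exp (deriv g B) * (h * g B) := by gcongr
    have e3 : h ^ 2 * (g (x (m + 1)) * (deriv g (x (m + 1)) * v (m + 1))) ≤
        h * (g B * (deriv g B * Real.exp (deriv g B))) := by
      gcongr
      nlinarith
    have e4 : h * (3 * (g B * deriv g B * Real.exp (deriv g B)) / g c) * g c ≤
      h * (3 * (g B * deriv g B * Real.exp (deriv g B)) / g c) * g (x 0) := by gcongr
    have e5 : h * (3 * (g B * deriv g B * Real.exp (deriv g B)) / g c) * g c =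
      h * (3 * (g B * deriv g B * Real.exp (deriv g B))) := by field_simp
    linarith
  generalize 3 * (g B * deriv g B * Real.exp (deriv g B)) / g c = K at *
  generalize g B ^ 2 / primG1 g c = Q at *
  generalize h * g (x 0) * g B ^ 2 / (2 * primG1 g (x 0)) = ε at *
  generalize x (m + 1) - x m = s at *
  generalize v (m + 1) - v m = t at *
  generalize g (x (m + 1)) = p at *
  generalize deriv g (x (m + 1)) = r at *
  generalize primG1 g (x (m + 1)) = G at *
  generalize v (m + 1) = w at *
  generalize primG1 g (x 0) = a at *
  generalize g (x 0) = b at *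
  have h1 : h ^ 2 * (p * w) ≤ h ^ 2 * b + s * t + h ^ 2 * (h * K * b) := by
    have := mul_le_mul_of_nonneg_left herr (sq_nonneg h)
    linarith
  have hKb : 0 ≤ h * K * b := le_trans (by positivity) herr
  have h2 : d * s * (h ^ 2 * (p * w)) ≤ d * s * (h ^ 2 * b + s * t + h ^ 2 * (h * K * b)) := by
    gcongr
  have h3 : s ^ 2 * t ≤ 2 * h ^ 2 * (G - a) * t := by gcongr
  have h4 : h ^ 2 * ((b / 2 - ε) * s) ≤ h ^ 2 * (a * t) := by gcongr
  have h5 : 0 < b * ((1 - d) - h * (Q + K)) := mul_pos hb (by linarith)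
  have h6 : 0 < h ^ 2 * (s * (b * (1 - d) - 2 * ε - h * K * b)) := by
    have : 0 < b * (1 - d) - 2 * ε - h * K * b := by linarith
    positivity
  have h7 : 0 ≤ (1 - d) * (s ^ 2 * t) := by
    have : 0 ≤ 1 - d := by linarith
    positivity
  have h8 : 0 ≤ (1 - d) * (h ^ 2 * (s * (h * K * b))) := by
    have : 0 ≤ 1 - d := by linarith
    positivity
  have h9 : 0 < h ^ 2 * (2 * G * t - d * p * w * s) := by linarith
  linarith [pos_of_mul_pos_right h9 (sq_nonneg h)]

/-- For a fine discretization, the last pivot of the Jacobian is positive. -/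
lemma last_pivot_pos (ho : IsLinearizedOrbit g h x v) (hg : IsConvexSource g)
    (hm : ((m : ℝ) + 1) * h = 1) {c B d α γ γ' : ℝ} (hd0 : 0 ≤ d) (hd1 : d < 1) (hc : 0 < c)
    (hcx : c ≤ x 0) (hB : x (m + 1) ≤ B)
    (hfine : h * (g B ^ 2 / primG1 g c +
      3 * (g B * deriv g B * Real.exp (deriv g B)) / g c) < 1 - d)
    (hγ : 0 < γ)
    (hend : x (m + 1) - x m = -(h ^ 2 / 2) * g (x (m + 1)) + h * α * γ)
    (hγ' : 0 ≤ d * g (x (m + 1)) / primG1 g (x (m + 1)) - 2 * γ' / γ) :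
    0 < (1 + h ^ 2 / 2 * deriv g (x (m + 1)) - h * α * γ') * v (m + 1) - v m := by
  have hmain := ho.mul_step_lt hg hm hd0 hd1 hc hcx hB hfine
  have hs := sub_nonneg.2 (ho.le_succ hg m)
  have hp := hg.pos (ho.pos hg (m + 1))
  have hG := hg.primG1_pos (ho.pos hg (m + 1))
  have hsq := hg.sq_le_two_mul_primG1_mul_deriv (ho.pos hg (m + 1)).le
  have hv : 0 < v (m + 1) := by linarith [ho.one_le_lin hg (m + 1)]
  generalize deriv g (x (m + 1)) = r at *
  generalize primG1 g (x (m + 1)) = G at *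
  generalize g (x (m + 1)) = p at *
  have h1 : 2 * G * γ' ≤ d * p * γ := by
    rw [sub_nonneg, div_le_div_iff₀ hγ hG] at hγ'
    linarith
  have h2 : h * α * γ = x (m + 1) - x m + h ^ 2 / 2 * p := by linarith
  have h3 : 0 ≤ h * α * γ := by rw [h2]; positivity
  have hα : 0 ≤ h * α := nonneg_of_mul_nonneg_left h3 hγ
  have h4 : h * α * v (m + 1) * (2 * G * γ') ≤ h * α * v (m + 1) * (d * p * γ) := by gcongr
  have h5 : h * α * v (m + 1) * (d * p * γ) =
      d * p * v (m + 1) * (x (m + 1) - x m + h ^ 2 / 2 * p) := by rw [← h2]; ring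
  have h6 : h ^ 2 / 2 * v (m + 1) * p ^ 2 ≤ h ^ 2 / 2 * v (m + 1) * (2 * G * r) := by gcongr
  have h7 : d * (h ^ 2 / 2 * v (m + 1) * p ^ 2) ≤ 1 * (h ^ 2 / 2 * v (m + 1) * p ^ 2) := by
    gcongr
  have h8 : 0 < (2 * G) *
      ((1 + h ^ 2 / 2 * r - h * α * γ') * v (m + 1) - v m) := by linarith
  exact pos_of_mul_pos_right h8 (by positivity)

/-- A priori bounds, uniform in the discretization. -/
lemma exists_bounds {g₁ g₂ : ℝ → ℝ} (hg₁ : IsConvexSource g₁) (hg₂ : IsConvexSource g₂)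
    {α : ℝ} (hα : 0 < α)
    (hgmono : StrictMonoOn (gg g₁ g₂) (Set.Ioi 0))
    (hgbij : Set.BijOn (gg g₁ g₂) (Set.Ioi 0) (Set.Ioi 0))
    (hGmono : StrictMonoOn (GG g₁ g₂) (Set.Ioi 0))
    (hGbij : Set.BijOn (GG g₁ g₂) (Set.Ioi 0) (Set.Ioi 0)) :
    ∃ c B : ℝ, 0 < c ∧ 0 < B ∧ ∀ (m : ℕ) (h : ℝ) (x v : ℕ → ℝ), ((m : ℝ) + 1) * h = 1 →
      IsLinearizedOrbit g₁ h x v →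
      x (m + 1) - x m = -(h ^ 2 / 2) * g₁ (x (m + 1)) + h * α * g₂ (x (m + 1)) →
      c ≤ x 0 ∧ x (m + 1) ≤ B := by
  obtain ⟨c₀, hc₀, hgc₀⟩ := hgbij.surjOn (show α ∈ Set.Ioi 0 from hα)
  have hg1 := hg₁.pos one_pos
  set κ := min (g₁ 1 / 2) 1 with hκ
  have hκ0 : 0 < κ := lt_min (by positivity) one_pos
  obtain ⟨B₀, hB₀, hGB₀⟩ := hGbij.surjOn
    (show (1 + κ) * α ^ 2 / κ ∈ Set.Ioi 0 from by simp only [Set.mem_Ioi]; positivity)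
  have hB : (0 : ℝ) < max 2 B₀ := lt_max_of_lt_left two_pos
  refine ⟨c₀ / Real.exp (deriv g₁ (max 2 B₀)), max 2 B₀,
    div_pos hc₀ (Real.exp_pos _), hB, fun m h x v hm ho hend => ?_⟩
  have hh : 0 < h := pos_of_mul_pos_right (hm ▸ one_pos) (by positivity)
  have hxm := ho.pos hg₁ (m + 1)
  have hγ := hg₂.pos hxm
  have hp := hg₁.pos hxm
  have hs := sub_nonneg.2 (ho.le_succ hg₁ m)
  have hlow : c₀ ≤ x (m + 1) := by
    rw [← hgmono.le_iff_le hc₀ hxm, hgc₀, gg, le_div_iff₀ hγ]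
    have h1 := ho.step_le hg₁ m
    have h2 : ((m : ℝ) + 1 / 2) * h ^ 2 * g₁ (x m) ≤
        ((m : ℝ) + 1 / 2) * h ^ 2 * g₁ (x (m + 1)) := by
      gcongr
      exact hg₁.mono (ho.pos hg₁ m).le (ho.le_succ hg₁ m)
    have h3 : h * (α * g₂ (x (m + 1))) ≤ h * (((m : ℝ) + 1) * h * g₁ (x (m + 1))) := by linarith
    rw [hm, one_mul] at h3
    exact le_of_mul_le_mul_left h3 hh
  have hup : x (m + 1) ≤ max 2 B₀ := by
    rw [le_max_iff, or_iff_not_imp_left, not_le]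
    intro h2x
    have hx0 := ho.pos_zero
    have hgap : x 0 + g₁ (x 0) / 2 ≤ x (m + 1) := by
      have := ho.le_sub_zero hg₁ (m + 1)
      have e : (((m + 1 : ℕ) : ℝ)) ^ 2 / 2 * h ^ 2 * g₁ (x 0) = g₁ (x 0) / 2 := by
        push_cast
        calc _ = (((m : ℝ) + 1) * h) ^ 2 * (g₁ (x 0) / 2) := by ring
          _ = _ := by rw [hm]; ring
      linarith
    have hratio : (1 + κ) * x 0 ≤ x (m + 1) := by
      rcases le_total 1 (x 0) with h1 | h1
      · have := hg₁.mul_le_mul one_pos h1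
        nlinarith [min_le_left (g₁ 1 / 2) 1]
      · nlinarith [min_le_right (g₁ 1 / 2) 1]
    have hG0 := hg₁.primG1_pos ho.pos_zero
    have hsec := hg₁.primG1_mul_le ho.pos_zero (ho.monotone hg₁ (Nat.zero_le (m + 1)))
    have hGr : (1 + κ) * primG1 g₁ (x 0) ≤ primG1 g₁ (x (m + 1)) := by
      have := mul_le_mul_of_nonneg_left hratio hG0.le
      exact le_of_mul_le_mul_left (by linarith) hx0
    have hE := ho.le_step_sq hg₁ m
    have hen : primG1 g₁ (x (m + 1)) - primG1 g₁ (x 0) ≤ α ^ 2 * g₂ (x (m + 1)) ^ 2 := by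
      have e : (h * α * g₂ (x (m + 1))) ^ 2 =
          (x (m + 1) - x m + h ^ 2 / 2 * g₁ (x (m + 1))) ^ 2 := by
        congr 1; linarith
      have h1 : 2 * h ^ 2 * (primG1 g₁ (x (m + 1)) - primG1 g₁ (x 0)) ≤
          2 * h ^ 2 * (α ^ 2 * g₂ (x (m + 1)) ^ 2) := by
        nlinarith [sq_nonneg (x (m + 1) - x m), sq_nonneg (h ^ 2 * g₁ (x (m + 1)))]
      exact le_of_mul_le_mul_left h1 (by positivity)
    rw [← hGmono.le_iff_le hxm hB₀, hGB₀, GG, div_le_div_iff₀ (by positivity) hκ0]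
    nlinarith
  refine ⟨?_, hup⟩
  rw [div_le_iff₀ (Real.exp_pos _), mul_comm]
  exact hlow.trans (ho.le_exp_mul hg₁ hm hup)

end IsLinearizedOrbit

section Jacobi

variable {n : ℕ}

/-- The symmetric tridiagonal matrix with diagonal `γ` and off-diagonal entries `-1`. -/
def jacobiMatrix (n : ℕ) (γ : ℕ → ℝ) : Matrix (Fin n) (Fin n) ℝ :=
  Matrix.of fun i j =>
    if i = j then γ i else if (i : ℕ) + 1 = (j : ℕ) ∨ (j : ℕ) + 1 = (i : ℕ) then -1 else 0

lemma sum_jacobiMatrix_mul (γ f : ℕ → ℝ) (i : Fin n) :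
    ∑ k : Fin n, jacobiMatrix n γ i k * f k =
      γ i * f i - (if 0 < (i : ℕ) then f (i - 1) else 0) -
        (if (i : ℕ) + 1 < n then f (i + 1) else 0) := by
  obtain ⟨i, hi⟩ := i
  have hsplit (k : ℕ) : (if i = k then γ i else if i + 1 = k ∨ k + 1 = i then -1 else 0) * f k =
      (if i = k then γ i * f i else 0)
        - (if k = i - 1 then (if 0 < i then f (i - 1) else 0) else 0)
        - (if i + 1 = k then f (i + 1) else 0) := by
    grind
  have hrange := Fin.sum_univ_eq_sum_range
    (fun k => (if i = k then γ i else if i + 1 = k ∨ k + 1 = i then -1 else 0) * f k) n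
  simp only [jacobiMatrix, Matrix.of_apply, Fin.ext_iff]
  rw [hrange]
  simp only [hsplit, Finset.sum_sub_distrib, Finset.sum_ite_eq, Finset.sum_ite_eq',
    Finset.mem_range]
  rw [if_pos hi, if_pos (by omega : i - 1 < n)]

/-- The determinant of a Jacobi matrix, from a solution `w` of the associated recurrence. -/
lemma det_jacobiMatrix (hn : 0 < n) {γ w : ℕ → ℝ} (hw : ∀ k < n, w k ≠ 0) (hw0 : w 0 = 1)
    (hγ0 : γ 0 * w 0 = w 1) (hγ : ∀ k, k + 1 < n → γ (k + 1) * w (k + 1) = w (k + 2) + w k) :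
    (jacobiMatrix n γ).det = w n := by
  obtain ⟨n, rfl⟩ : ∃ m, n = m + 1 := ⟨n - 1, by omega⟩
  let C : Matrix (Fin (n + 1)) (Fin (n + 1)) ℝ :=
    Matrix.of fun i j => if (i : ℕ) ≤ (j : ℕ) then w i else 0
  have hC : C.det = ∏ i : Fin (n + 1), w i := by
    rw [Matrix.det_of_isUpperTriangular]
    · simp [C]
    · intro i j hij
      exact if_neg (not_le.2 hij)
  have hmul (i j : Fin (n + 1)) : (jacobiMatrix (n + 1) γ * C) i j =
      γ i * (if (i : ℕ) ≤ (j : ℕ) then w i else 0)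
        - (if 0 < (i : ℕ) then (if (i : ℕ) - 1 ≤ (j : ℕ) then w (i - 1) else 0) else 0)
        - (if (i : ℕ) + 1 < n + 1 then (if (i : ℕ) + 1 ≤ (j : ℕ) then w (i + 1) else 0) else 0) :=
    sum_jacobiMatrix_mul γ (fun k => if k ≤ (j : ℕ) then w k else 0) i
  have hJC : (jacobiMatrix (n + 1) γ * C).det = ∏ i : Fin (n + 1), w (i + 1) := by
    rw [Matrix.det_of_isLowerTriangular]
    · refine Finset.prod_congr rfl fun i _ => ?_
      rw [hmul]
      obtain ⟨i, hi⟩ := i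
      rcases i with _ | i
      · simp [hγ0]
      · simp [hγ i hi]
    · intro i j hij
      have hij : (i : ℕ) < j := hij
      rw [hmul]
      obtain ⟨i, hi⟩ := i
      obtain ⟨j, hj⟩ := j
      have hij : i < j := hij
      rcases i with _ | i
      · have : 1 ≤ j := by omega
        simp [hγ0, this, show 0 < n by omega]
      · simp [hγ i hi, hij.le, show i ≤ j by omega, show i + 1 + 1 ≤ j by omega,
          show i + 1 < n by omega]
  have hprod : ∏ i : Fin (n + 1), w (i + 1) = w (n + 1) * ∏ i : Fin (n + 1), w i := by
    rw [Fin.prod_univ_eq_prod_range (fun i => w (i + 1)), Fin.prod_univ_eq_prod_range,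
      Finset.prod_range_succ, Finset.prod_range_succ', hw0]
    ring
  have hne : ∏ i : Fin (n + 1), w i ≠ 0 := Finset.prod_ne_zero_iff.2 fun i _ => hw i i.2
  rw [Matrix.det_mul, hC, hprod] at hJC
  exact mul_right_cancel₀ hne hJC

/-- The inverse of a Jacobi matrix, from a solution `w` of the associated recurrence. -/
lemma inv_jacobiMatrix_apply {γ w : ℕ → ℝ} (hw : ∀ k ≤ n, w k ≠ 0)
    (hγ0 : γ 0 * w 0 = w 1) (hγ : ∀ k, k + 1 < n → γ (k + 1) * w (k + 1) = w (k + 2) + w k)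
    (i j : Fin n) :
    (jacobiMatrix n γ)⁻¹ i j =
      w i * w j * ∑ k ∈ Finset.Ico (max (i : ℕ) j) n, 1 / (w k * w (k + 1)) := by
  set c : ℕ → ℝ := fun l => ∑ k ∈ Finset.Ico l n, 1 / (w k * w (k + 1)) with hc
  have hc_succ (l : ℕ) (hl : l < n) : c l = 1 / (w l * w (l + 1)) + c (l + 1) :=
    Finset.sum_eq_sum_Ico_succ_bot hl _
  have hc_last : c n = 0 := by simp [hc]
  suffices hinv : jacobiMatrix n γ *
      (Matrix.of fun i j : Fin n => w i * w j * c (max (i : ℕ) j)) = 1 by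
    rw [Matrix.inv_eq_right_inv hinv, Matrix.of_apply]
  ext i j
  have hmul := sum_jacobiMatrix_mul γ (fun k => w k * w j * c (max k (j : ℕ))) i
  rw [Matrix.mul_apply]
  simp only [Matrix.of_apply]
  rw [hmul, Matrix.one_apply]
  obtain ⟨i, hi⟩ := i
  obtain ⟨j, hj⟩ := j
  simp only [Fin.mk.injEq]
  have hlast : (if i + 1 < n then w (i + 1) * w j * c (max (i + 1) j) else 0) =
      w (i + 1) * w j * c (max (i + 1) j) := by
    split_ifs with h
    · rfl
    · rw [show max (i + 1) j = n by omega, hc_last, mul_zero]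
  rw [hlast]
  have hwi := hw i hi.le
  have hwi1 := hw (i + 1) hi
  have hfirst : γ i * (w i * w j * c (max i j)) -
      (if 0 < i then w (i - 1) * w j * c (max (i - 1) j) else 0) =
      w (i + 1) * w j * c (max i j) - if j < i then w j / w i else 0 := by
    rcases i with _ | i
    · simp [← hγ0]; ring
    · have hwi' := hw i (by omega)
      simp only [Nat.succ_pos, if_true, Nat.add_sub_cancel]
      have hrec := hγ i hi
      rcases le_or_gt (i + 1) j with hij | hij
      · rw [if_neg (by omega), max_eq_right hij, max_eq_right (by omega : i ≤ j)]
        linear_combination w j * c j * hrec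
      · rw [if_pos hij, max_eq_left hij.le, max_eq_left (by omega : j ≤ i),
          hc_succ i (by omega)]
        field_simp
        linear_combination w j * w (i + 1) * c (i + 1) * hrec
  rw [hfirst]
  rcases lt_trichotomy i j with hij | rfl | hij
  · rw [if_neg (by omega), if_neg (by omega), max_eq_right hij.le,
      max_eq_right (by omega : i + 1 ≤ j)]
    ring
  · rw [if_neg (by omega), if_pos rfl, max_self, max_eq_left (by omega : i ≤ i + 1), hc_succ i hi]
    field_simp
    ring
  · rw [if_pos hij, if_neg (by omega), max_eq_left hij.le, max_eq_left (by omega : j ≤ i + 1),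
      hc_succ i hi]
    field_simp
    ring

end Jacobi

section Solution

variable {g₁ g₂ : ℝ → ℝ} {h : ℝ}

lemma hasDerivAt_Useq (hg : IsConvexSource g₁) (x : ℝ) (k : ℕ) :
    HasDerivAt (Useq g₁ h k) (deriv (Useq g₁ h k) x) x ∧
      HasDerivAt (Useq g₁ h (k + 1)) (deriv (Useq g₁ h (k + 1)) x) x := by
  simp only [hasDerivAt_deriv_iff]
  induction k with
  | zero =>
    exact ⟨differentiableAt_id,
      differentiableAt_id.add ((hg.differentiable x).const_mul (h ^ 2 / 2))⟩
  | succ k ih =>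
    exact ⟨ih.2, ((ih.2.const_mul 2).sub ih.1).add
      (((hg.differentiable _).comp x ih.2).const_mul (h ^ 2))⟩

lemma isLinearizedOrbit_Useq (hg : IsConvexSource g₁) {x : ℝ} (hx : 0 < x) :
    IsLinearizedOrbit g₁ h (fun k => Useq g₁ h k x) (fun k => deriv (Useq g₁ h k) x) where
  pos_zero := hx
  one := rfl
  add_two _ := rfl
  lin_zero := deriv_id x
  lin_one := ((hasDerivAt_id x).add ((hg.hasDerivAt x).const_mul (h ^ 2 / 2))).deriv
  lin_add_two k :=
    have h1 := (hasDerivAt_Useq (h := h) hg x k).1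
    have h2 := (hasDerivAt_Useq (h := h) hg x k).2
    (((h2.const_mul 2).sub h1).add (((hg.hasDerivAt _).comp x h2).const_mul (h ^ 2))).deriv

lemma IsSolution.eq_Useq {n : ℕ} {α : ℝ} {u : ℕ → ℝ} (hu : IsSolution g₁ g₂ n h α u) (k : ℕ) :
    (k + 1 ≤ n → u (k + 1) = Useq g₁ h k (u 1)) ∧
      (k + 2 ≤ n → u (k + 2) = Useq g₁ h (k + 1) (u 1)) := by
  obtain ⟨-, h1, h2, -⟩ := hu
  induction k with
  | zero => exact ⟨fun _ => rfl, fun _ => by simp only [Useq]; linarith⟩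
  | succ k ih =>
    refine ⟨ih.2, fun hk => ?_⟩
    have h3 := h2 (k + 2) (by omega) (by omega)
    rw [Nat.add_sub_assoc (by norm_num), ih.2 (by omega), ih.1 (by omega)] at h3
    simp only [Useq]
    linarith

end Solution

theorem stmt_17
    (g1 g2 : ℝ → ℝ)
    (hg1C : ContDiff ℝ 3 g1) (hg2C : ContDiff ℝ 3 g2)
    (hg10 : g1 0 = 0) (hg20 : g2 0 = 0)
    (hg1d : ∀ x > (0:ℝ), 0 < deriv g1 x) (hg2d : ∀ x > (0:ℝ), 0 < deriv g2 x)
    (hg1dd : ∀ x > (0:ℝ), 0 < deriv (deriv g1) x)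
    (hg2dd : ∀ x > (0:ℝ), 0 < deriv (deriv g2) x)
    (hg1ddd : ∀ x > (0:ℝ), 0 ≤ deriv (deriv (deriv g1)) x)
    (hg2ddd : ∀ x > (0:ℝ), 0 ≤ deriv (deriv (deriv g2)) x)
    (α : ℝ) (hα : 0 < α)
    (hgmono : StrictMonoOn (gg g1 g2) (Set.Ioi 0))
    (hgbij : Set.BijOn (gg g1 g2) (Set.Ioi 0) (Set.Ioi 0))
    (hGmono : StrictMonoOn (GG g1 g2) (Set.Ioi 0))
    (hGbij : Set.BijOn (GG g1 g2) (Set.Ioi 0) (Set.Ioi 0))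
    (d : ℝ) (hd0 : 0 ≤ d) (hd1 : d < 1)
    (hH2 : ∀ x > (0:ℝ), 0 ≤ d * g1 x / primG1 g1 x - 2 * deriv g2 x / g2 x)
    (hH3 : ∀ x > (0:ℝ), 0 ≤ deriv (deriv (GG g1 g2)) x) :
    ∃ M > (0:ℝ), ∀ n : ℕ, 1 + M / (2 - 2 * d) < (n : ℝ) →
      ∀ u : ℕ → ℝ, IsSolution g1 g2 n (1 / ((n : ℝ) - 1)) α u →
        (Jmat g1 g2 n (1 / ((n : ℝ) - 1)) α u).det ≠ 0 ∧
        ∀ i j : Fin n,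
          (Jmat g1 g2 n (1 / ((n : ℝ) - 1)) α u)⁻¹ i j =
            (∑ k ∈ Finset.Icc (max ((i : ℕ) + 1) ((j : ℕ) + 1)) (n - 1),
              deriv (discU g1 (1 / ((n : ℝ) - 1)) ((i : ℕ) + 1)) (u 1) *
                deriv (discU g1 (1 / ((n : ℝ) - 1)) ((j : ℕ) + 1)) (u 1) /
              (deriv (discU g1 (1 / ((n : ℝ) - 1)) k) (u 1) *
                deriv (discU g1 (1 / ((n : ℝ) - 1)) (k + 1)) (u 1))) +
            deriv (discU g1 (1 / ((n : ℝ) - 1)) ((i : ℕ) + 1)) (u 1) *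
              deriv (discU g1 (1 / ((n : ℝ) - 1)) ((j : ℕ) + 1)) (u 1) /
            (deriv (discU g1 (1 / ((n : ℝ) - 1)) n) (u 1) *
              (Jmat g1 g2 n (1 / ((n : ℝ) - 1)) α u).det) := by
  have hg₁ : IsConvexSource g1 := ⟨hg1C, hg10, hg1d, hg1dd⟩
  have hg₂ : IsConvexSource g2 := ⟨hg2C, hg20, hg2d, hg2dd⟩
  obtain ⟨c, B, hc, hB, hbounds⟩ :=
    IsLinearizedOrbit.exists_bounds hg₁ hg₂ hα hgmono hgbij hGmono hGbij
  have hgB := hg₁.pos hB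
  have hgc := hg₁.pos hc
  have hGc := hg₁.primG1_pos hc
  have hLB := hg1d B hB
  refine ⟨2 * (g1 B ^ 2 / primG1 g1 c +
    3 * (g1 B * deriv g1 B * Real.exp (deriv g1 B)) / g1 c), by positivity, ?_⟩
  intro n hn u hu
  generalize hK : g1 B ^ 2 / primG1 g1 c +
    3 * (g1 B * deriv g1 B * Real.exp (deriv g1 B)) / g1 c = K at hn
  have hK0 : 0 < K := by rw [← hK]; positivity
  have hd2 : 0 < 2 - 2 * d := by linarith
  have hn1 : (1 : ℝ) < n := by linarith [div_pos (mul_pos two_pos hK0) hd2]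
  obtain ⟨m, rfl⟩ : ∃ m, n = m + 2 := ⟨n - 2, (Nat.sub_add_cancel (Nat.one_lt_cast.1 hn1)).symm⟩
  generalize hh : (1 : ℝ) / (((m + 2 : ℕ) : ℝ) - 1) = h at *
  have hm : ((m : ℝ) + 1) * h = 1 := by
    rw [← hh]
    push_cast
    have : (m : ℝ) + 2 - 1 ≠ 0 := by linarith [(Nat.cast_nonneg m : (0 : ℝ) ≤ m)]
    field_simp
    ring
  have hh0 : 0 < h := pos_of_mul_pos_right (hm ▸ one_pos) (by positivity)
  have hfine : h * K < 1 - d := by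
    have h1 : 2 * K < ((m : ℝ) + 1) * (2 - 2 * d) := by
      rw [← div_lt_iff₀ hd2]
      push_cast at hn
      linarith
    have h2 : h * (2 * K) < h * (((m : ℝ) + 1) * (2 - 2 * d)) := by gcongr
    have h3 : h * (((m : ℝ) + 1) * (2 - 2 * d)) = 2 - 2 * d := by
      linear_combination (2 - 2 * d) * hm
    linarith
  have ho := isLinearizedOrbit_Useq (h := h) hg₁ (hu.1 1 le_rfl (by omega))
  have hux (k : ℕ) (hk : k ≤ m + 1) : u (k + 1) = Useq g1 h k (u 1) :=
    (hu.eq_Useq k).1 (by omega)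
  have hend := hu.2.2.2
  rw [show m + 2 - 1 = m + 1 by omega, hux m (by omega), hux (m + 1) le_rfl] at hend
  obtain ⟨hcx, hxB⟩ := hbounds m h _ _ hm ho hend
  have hxn := ho.pos hg₁ (m + 1)
  have hpivot := ho.last_pivot_pos hg₁ hm hd0 hd1 hc hcx hxB (hK ▸ hfine) (hg₂.pos hxn) hend
    (hH2 _ hxn)
  set γ : ℕ → ℝ := fun k =>
    if k = 0 then 1 + h ^ 2 / 2 * deriv g1 (u 1)
    else if k = m + 1 then
      1 + h ^ 2 / 2 * deriv g1 (u (m + 2)) - h * α * deriv g2 (u (m + 2))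
    else 2 + h ^ 2 * deriv g1 (u (k + 1)) with hγ
  have hJ : Jmat g1 g2 (m + 2) h α u = jacobiMatrix (m + 2) γ := rfl
  set v : ℕ → ℝ := fun k => deriv (Useq g1 h k) (u 1) with hv
  set w : ℕ → ℝ := fun k => if k = m + 2 then γ (m + 1) * v (m + 1) - v m else v k with hw
  have hwv (k : ℕ) (hk : k ≤ m + 1) : w k = v k := if_neg (by omega)
  have hγn : γ (m + 1) = 1 + h ^ 2 / 2 * deriv g1 (Useq g1 h (m + 1) (u 1))
      - h * α * deriv g2 (Useq g1 h (m + 1) (u 1)) := by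
    simp only [hγ, hux (m + 1) le_rfl, if_neg (Nat.succ_ne_zero m), if_true]
  have hwn : w (m + 2) = γ (m + 1) * v (m + 1) - v m := if_pos rfl
  have hwne (k : ℕ) (hk : k ≤ m + 2) : w k ≠ 0 := by
    rcases hk.eq_or_lt with rfl | hk
    · rw [hwn, hγn]
      exact hpivot.ne'
    · rw [hwv k (by omega)]
      linarith [ho.one_le_lin hg₁ k]
  have hw0 : w 0 = 1 := ho.lin_zero
  have hγ0 : γ 0 * w 0 = w 1 := by
    rw [hw0, hwv 1 (by omega), mul_one]
    exact ho.lin_one.symm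
  have hrec (k : ℕ) (hk : k + 1 < m + 2) : γ (k + 1) * w (k + 1) = w (k + 2) + w k := by
    rw [hwv k (by omega), hwv (k + 1) (by omega)]
    rcases (show k ≤ m by omega).eq_or_lt with rfl | hk
    · rw [hwn]; ring
    · have hlin : v (k + 2) = _ := ho.lin_add_two k
      rw [hwv (k + 2) (by omega), hlin]
      simp only [hγ, if_neg (Nat.succ_ne_zero k), if_neg (show k + 1 ≠ m + 1 by omega),
        hux (k + 1) (by omega)]
      ring
  have hdet : (jacobiMatrix (m + 2) γ).det = w (m + 2) :=
    det_jacobiMatrix (by omega) (fun k hk => hwne k hk.le) hw0 hγ0 hrec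
  rw [hJ, hdet]
  refine ⟨hwne _ le_rfl, fun i j => ?_⟩
  rw [inv_jacobiMatrix_apply hwne hγ0 hrec, hwv i (by omega), hwv j (by omega),
    Finset.sum_Ico_succ_top (by omega), mul_add, Finset.mul_sum, hwv (m + 1) le_rfl]
  simp only [discU, Nat.add_sub_cancel]
  rw [show m + 2 - 1 = m + 1 by omega, Nat.add_max_add_right]
  congr 1
  · refine Finset.sum_bij (fun k _ => k + 1) ?_ ?_ ?_ ?_
    · intro k hk
      simp only [Finset.mem_Ico, Finset.mem_Icc] at hk ⊢
      omega
    · intro k _ l _ hkl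
      omega
    · intro k hk
      simp only [Finset.mem_Icc] at hk
      exact ⟨k - 1, by simp only [Finset.mem_Ico]; omega, by omega⟩
    · intro k hk
      simp only [Finset.mem_Ico] at hk
      rw [hwv k (by omega), hwv (k + 1) (by omega), Nat.add_sub_cancel]
      exact mul_one_div _ _
  · exact mul_one_div _ _
end
end

section
/- Let 0 < α_* < α^* be given constants (independent of n) and assume the standing hypotheses (H1)–(H3) with constant d ∈ [0,1). Then there exist constants κ₁ > 0 and M > 0, depending only on g₁, g₂, d, α_* and α^* (and not on n), such that for every integer n > 1 + M/(2−2d) and every u₁ > 0 with α_* ≤ A(u₁) ≤ α^* (A and U_n defined with this n), one has 0 < U_n′(u₁) < κ₁ · A′(u₁); i.e. the condition number U_n′(u₁)/A′(u₁) of the homotopy path is bounded by κ₁ uniformly in n. -/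
noncomputable section

/-- The derivative of `Useq g1 h k` with respect to the initial value. -/
def dUseq (g1 : ℝ → ℝ) (h : ℝ) : ℕ → ℝ → ℝ
  | 0 => fun _ => 1
  | 1 => fun x => 1 + h ^ 2 / 2 * deriv g1 x
  | k + 2 => fun x =>
      2 * dUseq g1 h (k + 1) x - dUseq g1 h k x +
        h ^ 2 * (deriv g1 (Useq g1 h (k + 1) x) * dUseq g1 h (k + 1) x)

theorem hasDerivAt_Useq_s19 {g1 : ℝ → ℝ} (hg : Differentiable ℝ g1) (h x : ℝ) :
    ∀ k, HasDerivAt (Useq g1 h k) (dUseq g1 h k x) x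
  | 0 => hasDerivAt_id x
  | 1 => (hasDerivAt_id x).add ((hg x).hasDerivAt.const_mul (h ^ 2 / 2))
  | k + 2 => by
    have h1 := hasDerivAt_Useq_s19 hg h x (k + 1)
    have h0 := hasDerivAt_Useq_s19 hg h x k
    exact ((h1.const_mul 2).sub h0).add
      (((hg (Useq g1 h (k + 1) x)).hasDerivAt.comp x h1).const_mul (h ^ 2))

/-- Leapfrog sequences: `u` is the position and `s` the velocity at half steps for the force `g`,
while `w`, `q` solve the linearized recursion (with `f` in the role of `g'`). -/
structure IsLeapfrog (g f : ℝ → ℝ) (h : ℝ) (u s w q : ℕ → ℝ) : Prop where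
  u_succ : ∀ j, u (j + 1) = u j + h * s j
  s_zero : s 0 = h / 2 * g (u 0)
  s_succ : ∀ j, s (j + 1) = s j + h * g (u (j + 1))
  w_zero : w 0 = 1
  w_succ : ∀ j, w (j + 1) = w j + h * q j
  q_zero : q 0 = h / 2 * f (u 0)
  q_succ : ∀ j, q (j + 1) = q j + h * (f (u (j + 1)) * w (j + 1))

theorem isLeapfrog_Useq (g1 : ℝ → ℝ) {h : ℝ} (hh : h ≠ 0) (x : ℝ) :
    IsLeapfrog g1 (deriv g1) h (fun k => Useq g1 h k x)
      (fun k => (Useq g1 h (k + 1) x - Useq g1 h k x) / h) (fun k => dUseq g1 h k x)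
      (fun k => (dUseq g1 h (k + 1) x - dUseq g1 h k x) / h) where
  u_succ j := by field_simp; ring
  s_zero := by simp only [Useq]; field_simp; ring
  s_succ j := by simp only [Useq]; field_simp; ring
  w_zero := rfl
  w_succ j := by field_simp; ring
  q_zero := by simp only [Useq, dUseq]; field_simp; ring
  q_succ j := by simp only [dUseq]; field_simp; ring

/-- The properties on `(0, ∞)` of a convex force `g` with convex derivative `f` and primitive `G`
that enter the discrete estimates. -/
structure IsConvexForce (g f G : ℝ → ℝ) : Prop where
  g_pos : ∀ x, 0 < x → 0 < g x
  f_pos : ∀ x, 0 < x → 0 < f x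
  f_mono : ∀ a b, 0 < a → a ≤ b → f a ≤ f b
  g_mono : ∀ a b, 0 < a → a ≤ b → g a ≤ g b
  g_sub_le : ∀ a b, 0 < a → a ≤ b → g b - g a ≤ f b * (b - a)
  g_sub_le_trapezoid : ∀ a b, 0 < a → a ≤ b → g b - g a ≤ (f a + f b) / 2 * (b - a)
  le_G_sub : ∀ a b, 0 < a → a ≤ b → g a * (b - a) ≤ G b - G a
  G_sub_le : ∀ a b, 0 < a → a ≤ b → G b - G a ≤ g b * (b - a)
  sq_le : ∀ x, 0 < x → g x ^ 2 ≤ 2 * G x * f x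

namespace IsLeapfrog

variable {g f G : ℝ → ℝ} {h : ℝ} {u s w q : ℕ → ℝ}

theorem pos (L : IsLeapfrog g f h u s w q) (F : IsConvexForce g f G) (hh : 0 < h)
    (h0 : 0 < u 0) (j : ℕ) : 0 < u j ∧ 0 < s j ∧ 0 < w j ∧ 0 < q j := by
  induction j with
  | zero =>
    have := F.g_pos _ h0
    have := F.f_pos _ h0
    refine ⟨h0, ?_, ?_, ?_⟩
    · rw [L.s_zero]; positivity
    · rw [L.w_zero]; positivity
    · rw [L.q_zero]; positivity
  | succ j ih =>
    obtain ⟨hu, hs, hw, hq⟩ := ih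
    have hu' : 0 < u (j + 1) := by rw [L.u_succ]; positivity
    have hw' : 0 < w (j + 1) := by rw [L.w_succ]; positivity
    have := F.g_pos _ hu'
    have := F.f_pos _ hu'
    refine ⟨hu', ?_, hw', ?_⟩
    · rw [L.s_succ]; positivity
    · rw [L.q_succ]; positivity

theorem u_le_succ (L : IsLeapfrog g f h u s w q) (F : IsConvexForce g f G) (hh : 0 < h)
    (h0 : 0 < u 0) (j : ℕ) : u j ≤ u (j + 1) := by
  have := mul_pos hh (L.pos F hh h0 j).2.1
  rw [L.u_succ]; linarith

theorem w_le_succ (L : IsLeapfrog g f h u s w q) (F : IsConvexForce g f G) (hh : 0 < h)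
    (h0 : 0 < u 0) (j : ℕ) : w j ≤ w (j + 1) := by
  have := mul_pos hh (L.pos F hh h0 j).2.2.2
  rw [L.w_succ]; linarith

theorem u_zero_le (L : IsLeapfrog g f h u s w q) (F : IsConvexForce g f G) (hh : 0 < h)
    (h0 : 0 < u 0) (j : ℕ) : u 0 ≤ u j :=
  monotone_nat_of_le_succ (L.u_le_succ F hh h0) (Nat.zero_le j)

theorem s_le (L : IsLeapfrog g f h u s w q) (F : IsConvexForce g f G) (hh : 0 < h)
    (h0 : 0 < u 0) (j : ℕ) : s j ≤ h * (j + 1 / 2) * g (u j) := by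
  induction j with
  | zero => rw [L.s_zero]; apply le_of_eq; push_cast; ring
  | succ j ih =>
    have hm := F.g_mono _ _ (L.pos F hh h0 j).1 (L.u_le_succ F hh h0 j)
    have : h * ((j : ℝ) + 1 / 2) * g (u j) ≤ h * (j + 1 / 2) * g (u (j + 1)) := by gcongr
    rw [L.s_succ]; push_cast; linarith

theorem le_s (L : IsLeapfrog g f h u s w q) (F : IsConvexForce g f G) (hh : 0 < h)
    (h0 : 0 < u 0) (j : ℕ) : h * (j + 1 / 2) * g (u 0) ≤ s j := by
  induction j with
  | zero => rw [L.s_zero]; apply le_of_eq; push_cast; ring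
  | succ j ih =>
    have hm := F.g_mono _ _ h0 (L.u_zero_le F hh h0 (j + 1))
    have : h * g (u 0) ≤ h * g (u (j + 1)) := by gcongr
    rw [L.s_succ]; push_cast; linarith

/-- One step of the monotonicity of the quotient `q / s`. -/
theorem q_mul_g_succ_le (L : IsLeapfrog g f h u s w q) (F : IsConvexForce g f G) (hh : 0 < h)
    (h0 : 0 < u 0) {j : ℕ} (hj : q j * g (u j) ≤ f (u j) * w j * s j) :
    q j * g (u (j + 1)) ≤ f (u (j + 1)) * w (j + 1) * s j := by
  obtain ⟨hu, hs, hw, hq⟩ := L.pos F hh h0 j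
  have hle := L.u_le_succ F hh h0 j
  have h1 := F.g_sub_le _ _ hu hle
  have h2 := F.f_mono _ _ hu hle
  have h3 : f (u j) * (w j * s j) ≤ f (u (j + 1)) * (w j * s j) := by gcongr
  have h4 : q j * (g (u (j + 1)) - g (u j)) ≤ q j * (f (u (j + 1)) * (u (j + 1) - u j)) := by
    gcongr
  have h5 : u (j + 1) - u j = h * s j := by rw [L.u_succ]; ring
  rw [h5] at h4
  rw [L.w_succ]
  linarith

theorem q_mul_g_le (L : IsLeapfrog g f h u s w q) (F : IsConvexForce g f G) (hh : 0 < h)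
    (h0 : 0 < u 0) (j : ℕ) : q j * g (u j) ≤ f (u j) * w j * s j := by
  induction j with
  | zero => rw [L.q_zero, L.s_zero, L.w_zero]; apply le_of_eq; ring
  | succ j ih =>
    have h1 := L.q_mul_g_succ_le F hh h0 ih
    rw [L.q_succ, L.s_succ]
    linarith

theorem ratio_le_force (L : IsLeapfrog g f h u s w q) (F : IsConvexForce g f G) (hh : 0 < h)
    (h0 : 0 < u 0) {j : ℕ} (hj : f (u 0) * s j ≤ g (u 0) * q j) :
    f (u 0) * g (u (j + 1)) ≤ g (u 0) * (f (u (j + 1)) * w (j + 1)) := by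
  have h1 := L.q_mul_g_succ_le F hh h0 (L.q_mul_g_le F hh h0 j)
  have hs := (L.pos F hh h0 j).2.1
  have hg := F.g_pos _ (L.pos F hh h0 (j + 1)).1
  have hg0 := F.g_pos _ h0
  refine le_of_mul_le_mul_right ?_ hs
  have h2 := mul_le_mul_of_nonneg_right hj hg.le
  have h3 := mul_le_mul_of_nonneg_left h1 hg0.le
  linarith

theorem ratio_le (L : IsLeapfrog g f h u s w q) (F : IsConvexForce g f G) (hh : 0 < h)
    (h0 : 0 < u 0) (j : ℕ) : f (u 0) * s j ≤ g (u 0) * q j := by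
  induction j with
  | zero => rw [L.q_zero, L.s_zero]; apply le_of_eq; ring
  | succ j ih =>
    have h1 := mul_le_mul_of_nonneg_left (L.ratio_le_force F hh h0 ih) hh.le
    rw [L.q_succ, L.s_succ]
    linarith

/-- A discrete Wronskian inequality. -/
theorem wronskian_le (L : IsLeapfrog g f h u s w q) (F : IsConvexForce g f G) (hh : 0 < h)
    (h0 : 0 < u 0) (j : ℕ) :
    w j * g (u j) ≤
      (q j - h / 2 * (f (u j) * w j)) * (s j - h / 2 * g (u j)) + g (u 0) := by
  induction j with
  | zero => rw [L.q_zero, L.s_zero, L.w_zero]; apply le_of_eq; ring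
  | succ j ih =>
    obtain ⟨hu, hs, hw, hq⟩ := L.pos F hh h0 j
    have hle := L.u_le_succ F hh h0 j
    have hwle := L.w_le_succ F hh h0 j
    have hfle := F.f_mono _ _ hu hle
    have hgle := F.g_mono _ _ hu hle
    have hg := F.g_pos _ hu
    have hf := F.f_pos _ hu
    have ht := F.g_sub_le_trapezoid _ _ hu hle
    have h5 : u (j + 1) - u j = h * s j := by rw [L.u_succ]; ring
    rw [h5] at ht
    have hw1 := (L.pos F hh h0 (j + 1)).2.2.1
    have hf1 := F.f_pos _ (L.pos F hh h0 (j + 1)).1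
    have hmono : f (u j) * w j * g (u j) ≤ f (u (j + 1)) * w (j + 1) * g (u (j + 1)) := by
      gcongr
    have hmono' := mul_le_mul_of_nonneg_left hmono (by positivity : (0 : ℝ) ≤ h ^ 2 / 4)
    have ht' := mul_le_mul_of_nonneg_left ht (by linarith : (0 : ℝ) ≤ (w (j + 1) + w j) / 2)
    have hcheb : 0 ≤ h * s j * ((w (j + 1) - w j) * (f (u (j + 1)) - f (u j))) :=
      mul_nonneg (by positivity) (mul_nonneg (by linarith) (by linarith))
    have hq' : q j * h = w (j + 1) - w j := by rw [L.w_succ]; ring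
    rw [L.q_succ, L.s_succ]
    generalize f (u (j + 1)) = f1 at *
    generalize g (u (j + 1)) = g1 at *
    generalize w (j + 1) = w1 at *
    have e1 : q j * h * g1 = (w1 - w j) * g1 := by rw [hq']
    have e2 : q j * h * g (u j) = (w1 - w j) * g (u j) := by rw [hq']
    nlinarith

theorem le_energy (L : IsLeapfrog g f h u s w q) (F : IsConvexForce g f G) (hh : 0 < h)
    (h0 : 0 < u 0) (j : ℕ) : G (u j) - G (u 0) ≤ (s j - h / 2 * g (u j)) ^ 2 := by
  induction j with
  | zero => rw [L.s_zero]; simp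
  | succ j ih =>
    obtain ⟨hu, hs, hw, hq⟩ := L.pos F hh h0 j
    have hle := L.u_le_succ F hh h0 j
    have hgle := F.g_mono _ _ hu hle
    have hg := F.g_pos _ hu
    have hG := F.G_sub_le _ _ hu hle
    have h5 : u (j + 1) - u j = h * s j := by rw [L.u_succ]; ring
    rw [h5] at hG
    rw [L.s_succ]
    have h6 : 0 ≤ h ^ 2 / 4 * (g (u (j + 1)) ^ 2 - g (u j) ^ 2) :=
      mul_nonneg (by positivity) (by nlinarith)
    have h7 : 0 ≤ h * s j * g (u j) := by positivity
    linarith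

theorem energy_le (L : IsLeapfrog g f h u s w q) (F : IsConvexForce g f G) (hh : 0 < h)
    (h0 : 0 < u 0) {S : ℝ} (j : ℕ) (hS : ∀ i < j, s i ≤ S) :
    (s j - h / 2 * g (u j)) ^ 2 ≤ 2 * (G (u j) - G (u 0)) + h * S * (g (u j) - g (u 0)) +
      h ^ 2 / 4 * (g (u j) ^ 2 - g (u 0) ^ 2) := by
  induction j with
  | zero => rw [L.s_zero]; simp
  | succ j ih =>
    have ih := ih fun i hi => hS i (by omega)
    obtain ⟨hu, hs, hw, hq⟩ := L.pos F hh h0 j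
    have hle := L.u_le_succ F hh h0 j
    have hgle := F.g_mono _ _ hu hle
    have hG := F.le_G_sub _ _ hu hle
    have h5 : u (j + 1) - u j = h * s j := by rw [L.u_succ]; ring
    rw [h5] at hG
    rw [L.s_succ]
    have h6 : h * s j * (g (u (j + 1)) - g (u j)) ≤ h * S * (g (u (j + 1)) - g (u j)) := by
      have := hS j (by omega)
      have : 0 ≤ g (u (j + 1)) - g (u j) := by linarith
      gcongr
    linarith

/-- The flux `V = s k + h / 2 * g v` at the last node `v = u (k + 1)` is at least `g (u 0)`. -/
theorem le_flux (L : IsLeapfrog g f h u s w q) (F : IsConvexForce g f G) (hh : 0 < h)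
    (h0 : 0 < u 0) {k : ℕ} (hk : h * ((k : ℝ) + 1) = 1) :
    g (u 0) ≤ s k + h / 2 * g (u (k + 1)) := by
  have h1 := L.le_s F hh h0 k
  have h2 := F.g_mono _ _ h0 (L.u_zero_le F hh h0 (k + 1))
  have h3 : h / 2 * g (u 0) ≤ h / 2 * g (u (k + 1)) := by gcongr
  have h4 : h * ((k : ℝ) + 1) * g (u 0) = g (u 0) := by rw [hk, one_mul]
  linarith

theorem G_sub_le_flux_sq (L : IsLeapfrog g f h u s w q) (F : IsConvexForce g f G) (hh : 0 < h)
    (h0 : 0 < u 0) (k : ℕ) :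
    G (u (k + 1)) - G (u 0) ≤ (s k + h / 2 * g (u (k + 1))) ^ 2 := by
  have h1 := L.le_energy F hh h0 (k + 1)
  have h2 : s (k + 1) - h / 2 * g (u (k + 1)) = s k + h / 2 * g (u (k + 1)) := by
    rw [L.s_succ]; ring
  rwa [h2] at h1

/-- The discrete energy exceeds the continuous one by a relative error of order `h`. -/
theorem flux_sq_le (L : IsLeapfrog g f h u s w q) (F : IsConvexForce g f G) (hh : 0 < h)
    (h0 : 0 < u 0) {k : ℕ} (hk : h * ((k : ℝ) + 1) = 1) :
    (s k + h / 2 * g (u (k + 1))) ^ 2 + 2 * G (u 0) ≤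
      2 * G (u (k + 1)) * (1 + 2 * h * f (u (k + 1))) := by
  have hS : ∀ i < k + 1, s i ≤ g (u (k + 1)) := by
    intro i hi
    have h1 := L.s_le F hh h0 i
    have h2 := F.g_mono _ _ (L.pos F hh h0 i).1
      (monotone_nat_of_le_succ (L.u_le_succ F hh h0) hi.le)
    have h3 := F.g_pos _ (L.pos F hh h0 i).1
    have h4 : (i : ℝ) + 1 / 2 ≤ k + 1 := by
      have : (i : ℝ) ≤ k := by exact_mod_cast Nat.lt_succ_iff.mp hi
      linarith
    calc s i ≤ h * (i + 1 / 2) * g (u i) := h1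
      _ ≤ h * (k + 1) * g (u (k + 1)) := by gcongr
      _ = g (u (k + 1)) := by rw [hk, one_mul]
  have h1 := L.energy_le F hh h0 (k + 1) hS
  have h2 : s (k + 1) - h / 2 * g (u (k + 1)) = s k + h / 2 * g (u (k + 1)) := by
    rw [L.s_succ]; ring
  rw [h2] at h1
  have hg0 := F.g_pos _ h0
  have hg := F.g_pos _ (L.pos F hh h0 (k + 1)).1
  have hle : h ≤ 1 := by
    have : (0 : ℝ) ≤ h * k := by positivity
    linarith
  have hsq := mul_le_mul_of_nonneg_left (F.sq_le _ (L.pos F hh h0 (k + 1)).1) hh.le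
  have h3 : 0 ≤ h * g (u (k + 1)) * g (u 0) := by positivity
  have h4 : h ^ 2 * g (u (k + 1)) ^ 2 ≤ h * g (u (k + 1)) ^ 2 := by
    have : h ^ 2 ≤ h := by nlinarith
    gcongr
  have h5 : 0 ≤ h ^ 2 * g (u 0) ^ 2 := by positivity
  nlinarith

/-- Lower bound for the logarithmic derivative of the flux. -/
theorem le_flux_deriv (L : IsLeapfrog g f h u s w q) (F : IsConvexForce g f G) (hh : 0 < h)
    (h0 : 0 < u 0) (k : ℕ) :
    (s k + h / 2 * g (u (k + 1))) * (w (k + 1) * g (u (k + 1))) ≤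
      (q k + h / 2 * (f (u (k + 1)) * w (k + 1))) *
        ((s k + h / 2 * g (u (k + 1))) ^ 2 + 2 * G (u 0)) := by
  have hW := L.wronskian_le F hh h0 (k + 1)
  have h2 : s (k + 1) - h / 2 * g (u (k + 1)) = s k + h / 2 * g (u (k + 1)) := by
    rw [L.s_succ]; ring
  have h3 : q (k + 1) - h / 2 * (f (u (k + 1)) * w (k + 1)) =
      q k + h / 2 * (f (u (k + 1)) * w (k + 1)) := by
    rw [L.q_succ]; ring
  rw [h2, h3] at hW
  have hr : f (u 0) * (s k + h / 2 * g (u (k + 1))) ≤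
      g (u 0) * (q k + h / 2 * (f (u (k + 1)) * w (k + 1))) := by
    have h4 := L.ratio_le F hh h0 k
    have h5 := mul_le_mul_of_nonneg_left (L.ratio_le_force F hh h0 h4) hh.le
    linarith
  have hg0 := F.g_pos _ h0
  have hf0 := F.f_pos _ h0
  have hg := F.g_pos _ (L.pos F hh h0 (k + 1)).1
  have hV : 0 < s k + h / 2 * g (u (k + 1)) := by
    have := (L.pos F hh h0 k).2.1
    positivity
  have hsq := F.sq_le _ h0
  have hG : 0 < G (u 0) := by
    by_contra! hneg
    nlinarith [sq_pos_of_pos hg0]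
  generalize s k + h / 2 * g (u (k + 1)) = V at *
  generalize q k + h / 2 * (f (u (k + 1)) * w (k + 1)) = p at *
  have h6 : g (u 0) * V ≤ 2 * G (u 0) * p := by
    refine le_of_mul_le_mul_left ?_ hg0
    have h7 := mul_le_mul_of_nonneg_right hsq hV.le
    have h8 := mul_le_mul_of_nonneg_left hr (by positivity : 0 ≤ 2 * G (u 0))
    nlinarith
  have h9 := mul_le_mul_of_nonneg_left hW hV.le
  nlinarith

end IsLeapfrog

theorem secant_bounds {F F' : ℝ → ℝ} (hF : ∀ x, HasDerivAt F (F' x) x)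
    (hmono : MonotoneOn F' (Set.Ici 0)) {a b : ℝ} (ha : 0 ≤ a) (hab : a ≤ b) :
    F' a * (b - a) ≤ F b - F a ∧ F b - F a ≤ F' b * (b - a) := by
  rcases hab.eq_or_lt with rfl | hlt
  · simp
  obtain ⟨c, hc, hc'⟩ := exists_hasDerivAt_eq_slope F F' hlt
    (fun x _ => (hF x).continuousAt.continuousWithinAt) (fun x _ => hF x)
  have hba : 0 < b - a := sub_pos.2 hlt
  have hslope : F b - F a = F' c * (b - a) := by rw [hc']; field_simp
  rw [hslope]
  have hc0 : 0 ≤ c := ha.trans hc.1.le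
  exact ⟨mul_le_mul_of_nonneg_right (hmono ha hc0 hc.1.le) hba.le,
    mul_le_mul_of_nonneg_right (hmono hc0 (ha.trans hab) hc.2.le) hba.le⟩

theorem monotoneOn_Ici_of_deriv_nonneg {f : ℝ → ℝ} (hf : Differentiable ℝ f)
    (h : ∀ x > (0 : ℝ), 0 ≤ deriv f x) : MonotoneOn f (Set.Ici 0) :=
  monotoneOn_of_deriv_nonneg (convex_Ici 0) hf.continuous.continuousOn hf.differentiableOn
    fun x hx => h x (by simpa using hx)

theorem hasDerivAt_primG1 {g1 : ℝ → ℝ} (hg : Continuous g1) (x : ℝ) :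
    HasDerivAt (primG1 g1) (g1 x) x :=
  intervalIntegral.integral_hasDerivAt_right (hg.intervalIntegrable _ _)
    (hg.stronglyMeasurableAtFilter _ _) hg.continuousAt

theorem primG1_zero (g1 : ℝ → ℝ) : primG1 g1 0 = 0 := intervalIntegral.integral_same

theorem differentiable_derivs {g : ℝ → ℝ} (hC : ContDiff ℝ 3 g) :
    Differentiable ℝ g ∧ Differentiable ℝ (deriv g) ∧ Differentiable ℝ (deriv (deriv g)) := by
  have h2 : ContDiff ℝ 2 (deriv g) := hC.deriv' (n := 2)
  have h1 : ContDiff ℝ 1 (deriv (deriv g)) := h2.deriv' (n := 1)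
  exact ⟨hC.differentiable (by norm_num), h2.differentiable (by norm_num),
    h1.differentiable (by norm_num)⟩

theorem pos_of_deriv_pos {g : ℝ → ℝ} (hg : Differentiable ℝ g) (h0 : g 0 = 0)
    (hd : ∀ x > (0 : ℝ), 0 < deriv g x) {x : ℝ} (hx : 0 < x) : 0 < g x := by
  have hmono : StrictMonoOn g (Set.Ici 0) :=
    strictMonoOn_of_deriv_pos (convex_Ici 0) hg.continuous.continuousOn
      fun y hy => hd y (by simpa using hy)
  simpa [h0] using hmono Set.self_mem_Ici hx.le hx

theorem isConvexForce_of_contDiff {g1 : ℝ → ℝ} (hC : ContDiff ℝ 3 g1) (h0 : g1 0 = 0)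
    (hd : ∀ x > (0 : ℝ), 0 < deriv g1 x) (hdd : ∀ x > (0 : ℝ), 0 ≤ deriv (deriv g1) x)
    (hddd : ∀ x > (0 : ℝ), 0 ≤ deriv (deriv (deriv g1)) x) :
    IsConvexForce g1 (deriv g1) (primG1 g1) := by
  obtain ⟨hD, hD', hD''⟩ := differentiable_derivs hC
  have mg : MonotoneOn g1 (Set.Ici 0) :=
    monotoneOn_Ici_of_deriv_nonneg hD fun x hx => (hd x hx).le
  have mf : MonotoneOn (deriv g1) (Set.Ici 0) := monotoneOn_Ici_of_deriv_nonneg hD' hdd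
  have mf' : MonotoneOn (deriv (deriv g1)) (Set.Ici 0) :=
    monotoneOn_Ici_of_deriv_nonneg hD'' hddd
  have hG := hasDerivAt_primG1 hD.continuous
  refine ⟨fun x hx => pos_of_deriv_pos hD h0 hd hx, hd,
    fun a b ha hab => mf ha.le (ha.le.trans hab) hab,
    fun a b ha hab => mg ha.le (ha.le.trans hab) hab,
    fun a b ha hab => (secant_bounds (fun x => (hD x).hasDerivAt) mf ha.le hab).2, ?_,
    fun a b ha hab => (secant_bounds hG mg ha.le hab).1,
    fun a b ha hab => (secant_bounds hG mg ha.le hab).2, ?_⟩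
  · intro a b ha hab
    have hφ : ∀ x, HasDerivAt (fun x => (deriv g1 a + deriv g1 x) / 2 * (x - a) - g1 x)
        (deriv (deriv g1) x / 2 * (x - a) + (deriv g1 a + deriv g1 x) / 2 * 1 - deriv g1 x) x :=
      fun x => (((((hD' x).hasDerivAt.const_add _).div_const 2).mul
        ((hasDerivAt_id x).sub_const a)).sub (hD x).hasDerivAt)
    have hm : MonotoneOn (fun x => (deriv g1 a + deriv g1 x) / 2 * (x - a) - g1 x)
        (Set.Ici a) := by
      refine monotoneOn_of_deriv_nonneg (convex_Ici a)
        (fun x _ => (hφ x).continuousAt.continuousWithinAt)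
        (fun x _ => (hφ x).differentiableAt.differentiableWithinAt) fun x hx => ?_
      rw [(hφ x).deriv]
      have hx : a < x := by simpa using hx
      have := (secant_bounds (fun x => (hD' x).hasDerivAt) mf' ha.le hx.le).2
      linarith
    have := hm Set.self_mem_Ici hab hab
    simp only [sub_self, mul_zero] at this
    linarith
  · intro x hx
    have hφ : ∀ x, HasDerivAt (fun x => 2 * primG1 g1 x * deriv g1 x - g1 x * g1 x)
        (2 * g1 x * deriv g1 x + 2 * primG1 g1 x * deriv (deriv g1) x -
          (deriv g1 x * g1 x + g1 x * deriv g1 x)) x :=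
      fun x => (((hG x).const_mul 2).mul (hD' x).hasDerivAt).sub
        ((hD x).hasDerivAt.mul (hD x).hasDerivAt)
    have hm := monotoneOn_Ici_of_deriv_nonneg (fun x => (hφ x).differentiableAt) fun y hy => by
      rw [(hφ y).deriv]
      have h1 := (secant_bounds hG mg le_rfl hy.le).1
      rw [primG1_zero, h0] at h1
      have h2 := mul_nonneg (by linarith : 0 ≤ primG1 g1 y) (hdd y hy)
      linarith
    have := hm Set.self_mem_Ici hx.le hx.le
    simp only [primG1_zero, h0] at this
    linarith

theorem primG1_le_mul {g1 f : ℝ → ℝ} (hC : Continuous g1)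
    (F : IsConvexForce g1 f (primG1 g1)) {x : ℝ} (hx : 0 < x) : primG1 g1 x ≤ g1 x * x := by
  have hlim : Filter.Tendsto (fun a => g1 x * (x - a) - (primG1 g1 x - primG1 g1 a))
      (nhdsWithin 0 (Set.Ioi 0)) (nhds (g1 x * (x - 0) - (primG1 g1 x - primG1 g1 0))) := by
    refine (ContinuousAt.tendsto ?_).mono_left nhdsWithin_le_nhds
    have := (hasDerivAt_primG1 hC 0).continuousAt
    fun_prop
  have hnonneg := ge_of_tendsto hlim (b := 0) (by
    filter_upwards [Ioo_mem_nhdsGT hx] with a ha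
    have := F.G_sub_le a x ha.1 ha.2.le
    linarith)
  rw [primG1_zero] at hnonneg
  linarith

/-- The node values `v` with bounded flux `V ≤ α * g2 v` are bounded. -/
theorem GG_le_of_flux_le {g1 g2 : ℝ → ℝ} (F : IsConvexForce g1 (deriv g1) (primG1 g1))
    (hC : ContDiff ℝ 3 g2) (h0 : g2 0 = 0) (hd : ∀ x > (0 : ℝ), 0 < deriv g2 x)
    (hdd : ∀ x > (0 : ℝ), 0 < deriv (deriv g2) x) (hg1C : Continuous g1)
    {α u v V : ℝ} (hα : 0 < α) (hu : 0 < u) (huv : u ≤ v) (hv : 1 ≤ v) (hV : 0 ≤ V)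
    (hVle : V ≤ α * g2 v) (hgV : g1 u ≤ V) (hGV : primG1 g1 v - primG1 g1 u ≤ V ^ 2) :
    GG g1 g2 v ≤ α ^ 2 + α / g2 1 := by
  obtain ⟨hD, hD', -⟩ := differentiable_derivs hC
  have hmono : MonotoneOn (deriv g2) (Set.Ici 0) :=
    monotoneOn_Ici_of_deriv_nonneg hD' fun x hx => (hdd x hx).le
  have hs := fun {a b : ℝ} => secant_bounds (a := a) (b := b) (fun x => (hD x).hasDerivAt) hmono
  have h1 : 0 < g2 1 := pos_of_deriv_pos hD h0 hd one_pos
  have hgv : 0 < g2 v := pos_of_deriv_pos hD h0 hd (by linarith)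
  have hlin : v * g2 1 ≤ g2 v := by
    have ha := (hs le_rfl zero_le_one).2
    have hb := (hs zero_le_one hv).1
    rw [h0] at ha
    have hc := mul_le_mul_of_nonneg_right (by linarith : g2 1 ≤ deriv g2 1)
      (by linarith : 0 ≤ v - 1)
    linarith
  have hGu := primG1_le_mul hg1C F hu
  have hkey : primG1 g1 v ≤ (α ^ 2 + α / g2 1) * g2 v ^ 2 := by
    have hg1u := F.g_pos _ hu
    have ha : V ^ 2 ≤ (α * g2 v) ^ 2 := by gcongr
    have hb : g1 u * u ≤ α * g2 v * (g2 v / g2 1) := by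
      have : u ≤ g2 v / g2 1 := huv.trans ((le_div_iff₀ h1).2 hlin)
      have := hgV.trans hVle
      gcongr
    calc primG1 g1 v ≤ (α * g2 v) ^ 2 + α * g2 v * (g2 v / g2 1) := by linarith
      _ = _ := by ring
  rw [GG, div_le_iff₀ (by positivity)]
  exact hkey

/-- The algebraic combination of the flux estimates into a lower bound for the numerator of the
derivative of `V / g2`. -/
theorem le_quotient_numerator {V w c p G G0 h f b b' d α B : ℝ} (hV : 0 < V) (hw : 0 < w)
    (hp : 0 < p) (hG : 0 < G) (hb : 0 < b) (hB : 0 < B) (hd0 : 0 ≤ d)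
    (hd1 : d < 1) (hflux : V * (w * c) ≤ p * (V ^ 2 + 2 * G0))
    (henergy : V ^ 2 + 2 * G0 ≤ 2 * G * (1 + 2 * h * f)) (hsmall : 2 * h * f ≤ (1 - d) / 2)
    (hb' : 2 * b' * G ≤ d * c * b) (hGc : G ≤ c * B) (hα : α * b ≤ V) :
    α * (1 - d) / (4 * B) * w * b ^ 2 ≤ p * b - V * (b' * w) := by
  have h1 : V * (w * c) ≤ 2 * G * p * (1 + (1 - d) / 2) := by
    calc V * (w * c) ≤ p * (2 * G * (1 + 2 * h * f)) := hflux.trans (by gcongr)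
      _ ≤ p * (2 * G * (1 + (1 - d) / 2)) := by gcongr
      _ = _ := by ring
  have h2 : V * (w * c) * (1 - (1 - d) / 2) ≤ 2 * G * p := by
    have h3 := mul_le_mul_of_nonneg_right h1 (by linarith : 0 ≤ 1 - (1 - d) / 2)
    have h4 : 0 ≤ 2 * G * p * ((1 - d) / 2) ^ 2 := by positivity
    linarith
  have h5 : V * w * c * b * ((1 - d) / 2) ≤ 2 * G * (p * b - V * (b' * w)) := by
    have h6 := mul_le_mul_of_nonneg_right h2 hb.le
    have h7 := mul_le_mul_of_nonneg_left hb' (by positivity : 0 ≤ V * w)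
    linarith
  have h8 : V * w * b * ((1 - d) / 2) * G ≤ 2 * B * (p * b - V * (b' * w)) * G := by
    have h9 := mul_le_mul_of_nonneg_left hGc
      (mul_nonneg (by positivity) (by linarith) : 0 ≤ V * w * b * ((1 - d) / 2))
    have h10 := mul_le_mul_of_nonneg_right h5 hB.le
    linarith
  have h11 := le_of_mul_le_mul_right h8 hG
  have h12 := mul_le_mul_of_nonneg_right hα
    (mul_nonneg (by positivity) (by linarith) : 0 ≤ w * b * ((1 - d) / 2))
  rw [div_mul_eq_mul_div, div_mul_eq_mul_div, div_le_iff₀ (by positivity)]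
  linarith

theorem hasDerivAt_discA {g1 g2 : ℝ → ℝ} (hg1 : Differentiable ℝ g1) (hg2 : Differentiable ℝ g2)
    (h x : ℝ) (k : ℕ) (hne : g2 (Useq g1 h (k + 1) x) ≠ 0) :
    HasDerivAt (discA g1 g2 h (k + 2))
      ((((dUseq g1 h (k + 1) x - dUseq g1 h k x) / h +
          h / 2 * (deriv g1 (Useq g1 h (k + 1) x) * dUseq g1 h (k + 1) x)) *
            g2 (Useq g1 h (k + 1) x) -
        ((Useq g1 h (k + 1) x - Useq g1 h k x) / h + h / 2 * g1 (Useq g1 h (k + 1) x)) *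
          (deriv g2 (Useq g1 h (k + 1) x) * dUseq g1 h (k + 1) x)) /
        g2 (Useq g1 h (k + 1) x) ^ 2) x := by
  have h1 := hasDerivAt_Useq_s19 hg1 h x (k + 1)
  have h0 := hasDerivAt_Useq_s19 hg1 h x k
  exact (((h1.sub h0).div_const h).add
    (((hg1 (Useq g1 h (k + 1) x)).hasDerivAt.comp x h1).const_mul (h / 2))).div
      ((hg2 (Useq g1 h (k + 1) x)).hasDerivAt.comp x h1) hne

theorem stmt_19
    (g1 g2 : ℝ → ℝ)
    (hg1C : ContDiff ℝ 3 g1) (hg2C : ContDiff ℝ 3 g2)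
    (hg10 : g1 0 = 0) (hg20 : g2 0 = 0)
    (hg1d : ∀ x > (0:ℝ), 0 < deriv g1 x) (hg2d : ∀ x > (0:ℝ), 0 < deriv g2 x)
    (hg1dd : ∀ x > (0:ℝ), 0 < deriv (deriv g1) x)
    (hg2dd : ∀ x > (0:ℝ), 0 < deriv (deriv g2) x)
    (hg1ddd : ∀ x > (0:ℝ), 0 ≤ deriv (deriv (deriv g1)) x)
    (hg2ddd : ∀ x > (0:ℝ), 0 ≤ deriv (deriv (deriv g2)) x)
    (αlow αhigh : ℝ) (hαlow : 0 < αlow) (hαs : αlow < αhigh)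
    (hgmono : StrictMonoOn (gg g1 g2) (Set.Ioi 0))
    (hgbij : Set.BijOn (gg g1 g2) (Set.Ioi 0) (Set.Ioi 0))
    (hGmono : StrictMonoOn (GG g1 g2) (Set.Ioi 0))
    (hGbij : Set.BijOn (GG g1 g2) (Set.Ioi 0) (Set.Ioi 0))
    (d : ℝ) (hd0 : 0 ≤ d) (hd1 : d < 1)
    (hH2 : ∀ x > (0:ℝ), 0 ≤ d * g1 x / primG1 g1 x - 2 * deriv g2 x / g2 x)
    (hH3 : ∀ x > (0:ℝ), 0 ≤ deriv (deriv (GG g1 g2)) x) :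
    ∃ κ₁ > (0:ℝ), ∃ M > (0:ℝ), ∀ n : ℕ, 1 + M / (2 - 2 * d) < (n : ℝ) →
      ∀ u1 > (0:ℝ),
        αlow ≤ discA g1 g2 (1 / ((n : ℝ) - 1)) n u1 →
        discA g1 g2 (1 / ((n : ℝ) - 1)) n u1 ≤ αhigh →
        0 < deriv (discU g1 (1 / ((n : ℝ) - 1)) n) u1 ∧
        deriv (discU g1 (1 / ((n : ℝ) - 1)) n) u1 <
          κ₁ * deriv (discA g1 g2 (1 / ((n : ℝ) - 1)) n) u1 := by
  have F := isConvexForce_of_contDiff hg1C hg10 hg1d (fun x hx => (hg1dd x hx).le) hg1ddd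
  have hD1 := (differentiable_derivs hg1C).1
  have hD2 := (differentiable_derivs hg2C).1
  have hg2pos : ∀ x > (0 : ℝ), 0 < g2 x := fun x hx => pos_of_deriv_pos hD2 hg20 hg2d hx
  have hαhigh : 0 < αhigh := hαlow.trans hαs
  obtain ⟨v₀, hv₀, hGv₀⟩ := hGbij.surjOn (show αhigh ^ 2 + αhigh / g2 1 ∈ Set.Ioi (0 : ℝ) by
    have := hg2pos 1 one_pos
    exact Set.mem_Ioi.2 (by positivity))
  set B := max 1 v₀
  have hB : 0 < B := lt_max_of_lt_left one_pos
  have hfB := hg1d B hB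
  have h1d : 0 < 1 - d := sub_pos.2 hd1
  refine ⟨8 * B / (αlow * (1 - d)), by positivity, 8 * deriv g1 B, by positivity, ?_⟩
  intro n hn u1 hu1 hlow hhigh
  have hn1 : 1 < n := by
    have : 0 < 8 * deriv g1 B / (2 - 2 * d) := div_pos (by positivity) (by linarith)
    exact_mod_cast (by linarith : (1 : ℝ) < n)
  obtain ⟨k, rfl⟩ : ∃ k, n = k + 2 := ⟨n - 2, by omega⟩
  have hcast : ((k + 2 : ℕ) : ℝ) - 1 = k + 1 := by push_cast; ring
  rw [hcast] at hlow hhigh ⊢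
  have hk0 : (0 : ℝ) < (k : ℝ) + 1 := by positivity
  have hsmall : 2 * (1 / ((k : ℝ) + 1)) * deriv g1 B ≤ (1 - d) / 2 := by
    have h2 : 8 * deriv g1 B / (2 - 2 * d) < k + 1 := by linarith
    rw [div_lt_iff₀ (by linarith)] at h2
    rw [mul_one_div, div_mul_eq_mul_div, div_le_iff₀ hk0]
    linarith
  have hk : 1 / ((k : ℝ) + 1) * ((k : ℝ) + 1) = 1 := one_div_mul_cancel hk0.ne'
  have hh : 0 < 1 / ((k : ℝ) + 1) := by positivity
  generalize 1 / ((k : ℝ) + 1) = h at *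
  have L := isLeapfrog_Useq g1 hh.ne' u1
  have h0 : 0 < Useq g1 h 0 u1 := hu1
  obtain ⟨hv, -, hw, -⟩ := L.pos F hh h0 (k + 1)
  obtain ⟨-, hs, -, hq⟩ := L.pos F hh h0 k
  have huv := L.u_zero_le F hh h0 (k + 1)
  have hgV := L.le_flux F hh h0 hk
  have hGV := L.G_sub_le_flux_sq F hh h0 k
  have henergy := L.flux_sq_le F hh h0 hk
  have hflux := L.le_flux_deriv F hh h0 k
  beta_reduce at hv hw hs hq huv hgV hGV henergy hflux
  have hb := hg2pos _ hv
  have hA := hasDerivAt_discA hD1 hD2 h u1 k hb.ne'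
  have hlow' : αlow * g2 (Useq g1 h (k + 1) u1) ≤ (Useq g1 h (k + 1) u1 - Useq g1 h k u1) / h +
      h / 2 * g1 (Useq g1 h (k + 1) u1) := (le_div_iff₀ hb).1 hlow
  have hhigh' : (Useq g1 h (k + 1) u1 - Useq g1 h k u1) / h +
      h / 2 * g1 (Useq g1 h (k + 1) u1) ≤ αhigh * g2 (Useq g1 h (k + 1) u1) :=
    (div_le_iff₀ hb).1 hhigh
  have hU : deriv (discU g1 h (k + 2)) u1 = dUseq g1 h (k + 1) u1 :=
    (hasDerivAt_Useq_s19 hD1 h u1 (k + 1)).deriv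
  rw [hU, hA.deriv]
  refine ⟨hw, ?_⟩
  have hc := F.g_pos _ hv
  have hf := F.f_pos _ hv
  have hV := add_pos hs (by positivity : 0 < h / 2 * g1 (Useq g1 h (k + 1) u1))
  have hp := add_pos hq (by positivity :
    0 < h / 2 * (deriv g1 (Useq g1 h (k + 1) u1) * dUseq g1 h (k + 1) u1))
  generalize (Useq g1 h (k + 1) u1 - Useq g1 h k u1) / h +
    h / 2 * g1 (Useq g1 h (k + 1) u1) = V at *
  generalize (dUseq g1 h (k + 1) u1 - dUseq g1 h k u1) / h +
    h / 2 * (deriv g1 (Useq g1 h (k + 1) u1) * dUseq g1 h (k + 1) u1) = p at *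
  generalize Useq g1 h (k + 1) u1 = v at *
  generalize dUseq g1 h (k + 1) u1 = w at *
  have hvB : v ≤ B := by
    by_contra! hlt
    have hle := GG_le_of_flux_le F hg2C hg20 hg2d hg2dd hD1.continuous hαhigh h0 huv
      ((le_max_left 1 v₀).trans hlt.le) hV.le hhigh' hgV hGV
    rw [← hGv₀] at hle
    exact absurd (hGmono hv₀ hv ((le_max_right 1 v₀).trans_lt hlt)) hle.not_gt
  have hG : 0 < primG1 g1 v := pos_of_deriv_pos
    (fun x => (hasDerivAt_primG1 hD1.continuous x).differentiableAt) (primG1_zero g1)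
    (fun x hx => by
      rw [(hasDerivAt_primG1 hD1.continuous x).deriv]; exact F.g_pos x hx) hv
  have hGc : primG1 g1 v ≤ g1 v * B :=
    (primG1_le_mul hD1.continuous F hv).trans (by gcongr)
  have hb' : 2 * deriv g2 v * primG1 g1 v ≤ d * g1 v * g2 v := by
    have h2 := sub_nonneg.1 (hH2 v hv)
    rwa [div_le_div_iff₀ hb hG] at h2
  have hsmall' : 2 * h * deriv g1 v ≤ (1 - d) / 2 := by
    have := F.f_mono _ _ hv hvB
    exact le_trans (by gcongr) hsmall
  have hmain := le_quotient_numerator hV hw hp hG hb hB hd0 hd1 hflux henergy hsmall' hb'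
    hGc hlow'
  rw [← le_div_iff₀ (by positivity)] at hmain
  calc w < 2 * w := by linarith
    _ = 8 * B / (αlow * (1 - d)) * (αlow * (1 - d) / (4 * B) * w) := by field_simp; norm_num
    _ ≤ _ := by gcongr
end
end
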